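/- arXiv:2105.08315 — 5 statements merged into one kernel-verified Lean document; each statement's English description precedes it below -/
import Mathlib

section
/- For every integer d ≥ 2 and real η ∈ (0,1/2), there exists an n₀ = n₀(η,d) such that the following holds for all n ≥ n₀. Let G be an n-vertex graph satisfying Δ(G) ≤ 10δ(G) and having the property that every vertex-induced subgraph H ⊆ G with minimum degree at least ℓ₂(η,d,δ(G)) := η·δ(G)/(40d²ln(2/η)) is a (1/(2d+2), d+1)-expander. Let v ∈ V(G) be arbitrary, and let T be a tree on at most (1−η)n vertices with a designated root vertex and maximum degree at most d. Then G contains a copy of T rooted at v, i.e. there is an injective graph homomorphism from T into G mapping the root of T to v. -/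
/-- The set of external neighbours of `X` in `H`. -/
def extNbrs {V : Type*} (H : SimpleGraph V) (X : Set V) : Set V :=
  {w | w ∉ X ∧ ∃ x ∈ X, H.Adj w x}

/-- A graph `H` with `m` vertices is an `(η, r)`-expander if every vertex set `X` of size at
most `η·m` has at least `r·|X|` external neighbours. -/
def IsExpander {V : Type*} (H : SimpleGraph V) (m : ℕ) (η : ℝ) (r : ℕ) : Prop :=
  ∀ X : Set V, (X.ncard : ℝ) ≤ η * m → r * X.ncard ≤ (extNbrs H X).ncard

/-- The degree of a vertex, as the cardinality of its neighbourhood. -/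
noncomputable def deg {V : Type*} (G : SimpleGraph V) (v : V) : ℕ :=
  (G.neighborSet v).ncard

/-- The minimum degree `δ(G)`. -/
noncomputable def minDeg {V : Type*} (G : SimpleGraph V) : ℕ := ⨅ v, deg G v

/-- The maximum degree `Δ(G)`. -/
noncomputable def maxDeg {V : Type*} (G : SimpleGraph V) : ℕ := ⨆ v, deg G v

section TreeEmbedding

open Finset

/-- The set of all vertices with a neighbour in `X`; unlike `extNbrs`, it may meet `X`. -/
noncomputable def allNbrs {V : Type*} [Fintype V] (G : SimpleGraph V) (X : Finset V) :
    Finset V := by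
  classical exact univ.filter fun w => ∃ x ∈ X, G.Adj x w

lemma mem_allNbrs {V : Type*} [Fintype V] {G : SimpleGraph V} {X : Finset V} {w : V} :
    w ∈ allNbrs G X ↔ ∃ x ∈ X, G.Adj x w := by
  simp [allNbrs]

/-- Every set of at most `b` vertices has enough neighbours outside the used set `S` to meet the
demands `r` of its vertices. -/
def MeetsDemands {V : Type*} [Fintype V] [DecidableEq V] (G : SimpleGraph V) (b : ℕ)
    (S : Finset V) (r : V → ℕ) : Prop :=
  ∀ X : Finset V, #X ≤ b → ∑ x ∈ X, r x ≤ #(allNbrs G X \ S)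

variable {V : Type*} [Fintype V] [DecidableEq V] {G : SimpleGraph V}

lemma card_allNbrs_union_add_inter_le (S A B : Finset V) :
    #(allNbrs G (A ∪ B) \ S) + #(allNbrs G (A ∩ B) \ S) ≤
      #(allNbrs G A \ S) + #(allNbrs G B \ S) := by
  rw [← card_union_add_card_inter (allNbrs G A \ S) (allNbrs G B \ S)]
  gcongr
  · intro w hw
    simp only [mem_sdiff, mem_allNbrs, mem_union] at hw ⊢
    grind
  · intro w hw
    simp only [mem_sdiff, mem_allNbrs, mem_inter] at hw ⊢
    grind

/-- If demands are met and the tight sets are small, then the tight sets are closed under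
union. -/
lemma MeetsDemands.tight_union {b M : ℕ} {S : Finset V} {r : V → ℕ} (hb : 2 * M ≤ b)
    (hS : MeetsDemands G b S r) {A B : Finset V} (hA : #A ≤ M)
    (hAt : #(allNbrs G A \ S) ≤ ∑ x ∈ A, r x) (hBt : #(allNbrs G B \ S) ≤ ∑ x ∈ B, r x) :
    #(allNbrs G (A ∪ B) \ S) ≤ ∑ x ∈ A ∪ B, r x := by
  have h1 := card_allNbrs_union_add_inter_le (G := G) S A B
  have h2 := sum_union_inter (s₁ := A) (s₂ := B) (f := r)
  have h3 := hS (A ∩ B) ((card_le_card inter_subset_left).trans (by omega))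
  omega

/-- The extension step of the Friedman–Pippenger tree embedding argument. -/
lemma MeetsDemands.exists_extension {d M N : ℕ} (hM : 1 ≤ M) {S : Finset V} {r : V → ℕ}
    (hlarge : ∀ X : Finset V, M < #X → #X ≤ 2 * M → d * #X + N ≤ #(allNbrs G X))
    (hS : MeetsDemands G (2 * M) S r) (hr : ∀ x, r x ≤ d) (hSN : #S < N)
    {u : V} (hu : 1 ≤ r u) :
    ∃ w, w ∉ S ∧ G.Adj u w ∧
      MeetsDemands G (2 * M) (insert w S) (fun x => if x = u ∨ x = w then r x - 1 else r x) := by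
  by_contra! hcon
  have hsmall : ∀ X : Finset V, #X ≤ 2 * M → #(allNbrs G X \ S) ≤ ∑ x ∈ X, r x → #X ≤ M := by
    intro X hX ht
    by_contra! hlt
    have h1 := hlarge X hlt hX
    have h2 : ∑ x ∈ X, r x ≤ #X • d := sum_le_card_nsmul _ _ _ fun x _ => hr x
    have h3 := le_card_sdiff S (allNbrs G X)
    rw [smul_eq_mul, mul_comm] at h2
    omega
  have htight : ∀ w, w ∉ S → G.Adj u w → ∃ X : Finset V, #X ≤ M ∧
      #(allNbrs G X \ S) ≤ ∑ x ∈ X, r x ∧ u ∉ X ∧ w ∈ allNbrs G X := by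
    intro w hwS huw
    have h := hcon w hwS huw
    simp only [MeetsDemands, not_forall, not_le] at h
    obtain ⟨X, hX, hlt⟩ := h
    have hle : ∑ x ∈ X, (if x = u ∨ x = w then r x - 1 else r x) ≤ ∑ x ∈ X, r x :=
      sum_le_sum fun x _ => by split_ifs <;> omega
    have hsd : allNbrs G X \ insert w S = (allNbrs G X \ S).erase w := by
      ext y; simp; tauto
    rw [hsd] at hlt
    have hge := hS X hX
    have hw : w ∈ allNbrs G X := by
      by_contra hw
      rw [erase_eq_of_notMem (by simp [hw])] at hlt
      omega
    rw [card_erase_of_mem (by simp [hw, hwS])] at hlt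
    have huX : u ∉ X := by
      intro huX
      have : ∑ x ∈ X, (if x = u ∨ x = w then r x - 1 else r x) < ∑ x ∈ X, r x := by
        refine sum_lt_sum (fun x _ => by split_ifs <;> omega) ⟨u, huX, ?_⟩
        rw [if_pos (Or.inl rfl)]; omega
      omega
    have ht : #(allNbrs G X \ S) ≤ ∑ x ∈ X, r x := by omega
    exact ⟨X, hsmall X hX ht, ht, huX, hw⟩
  have hcover : ∀ W : Finset V, (∀ w ∈ W, w ∉ S ∧ G.Adj u w) → ∃ X : Finset V, #X ≤ M ∧
      #(allNbrs G X \ S) ≤ ∑ x ∈ X, r x ∧ u ∉ X ∧ W ⊆ allNbrs G X := by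
    intro W
    induction W using Finset.induction_on with
    | empty => exact fun _ => ⟨∅, by simp, by simp [allNbrs], by simp, by simp⟩
    | insert w W _ ih =>
      intro hW
      obtain ⟨A, hA, hAt, huA, hWA⟩ := ih fun w' hw' => hW w' (mem_insert_of_mem hw')
      obtain ⟨hwS, huw⟩ := hW w (mem_insert_self _ _)
      obtain ⟨B, hB, hBt, huB, hwB⟩ := htight w hwS huw
      have ht := hS.tight_union le_rfl hA hAt hBt
      refine ⟨A ∪ B, hsmall _ ((card_union_le _ _).trans (by omega)) ht, ht, by simp [huA, huB],
        ?_⟩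
      intro y hy
      rw [mem_allNbrs]
      rcases mem_insert.1 hy with rfl | hy
      · obtain ⟨x, hx, hxy⟩ := mem_allNbrs.1 hwB
        exact ⟨x, mem_union_right _ hx, hxy⟩
      · obtain ⟨x, hx, hxy⟩ := mem_allNbrs.1 (hWA hy)
        exact ⟨x, mem_union_left _ hx, hxy⟩
  obtain ⟨X, hX, hXt, huX, hWX⟩ := hcover (allNbrs G {u} \ S) (by
    intro w hw
    simp only [mem_sdiff, mem_allNbrs, mem_singleton, exists_eq_left] at hw
    exact ⟨hw.2, hw.1⟩)
  have h1 := hS (insert u X) ((card_insert_le _ _).trans (by omega))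
  rw [sum_insert huX] at h1
  have h2 : allNbrs G (insert u X) \ S ⊆ allNbrs G X \ S := by
    intro w hw
    simp only [mem_sdiff, mem_allNbrs, mem_insert, exists_eq_or_imp] at hw
    obtain ⟨huw | hw1, hw2⟩ := hw
    · exact mem_sdiff.2 ⟨hWX (by simp [mem_allNbrs, huw, hw2]), hw2⟩
    · exact mem_sdiff.2 ⟨mem_allNbrs.2 hw1, hw2⟩
  have h3 := card_le_card h2
  omega

/-- The inductive form of the Friedman–Pippenger theorem: a rooted tree embeds in such a way that
all demands left over are met. -/
lemma exists_tree_embedding_meetsDemands {d M N : ℕ} (hM : 1 ≤ M)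
    (hsmall : ∀ X : Finset V, X.Nonempty → #X ≤ 2 * M → d * #X + 1 ≤ #(allNbrs G X))
    (hlarge : ∀ X : Finset V, M < #X → #X ≤ 2 * M → d * #X + N ≤ #(allNbrs G X))
    (v : V) (k : ℕ) : ∀ (W : Type) [Finite W] (T : SimpleGraph W), T.IsTree → Nat.card W = k →
      k ≤ N → (∀ x, deg T x ≤ d) → ∀ root : W, ∃ (f : W → V) (S : Finset V) (r : V → ℕ),
        Function.Injective f ∧ f root = v ∧ (∀ x y, T.Adj x y → G.Adj (f x) (f y)) ∧
        (∀ x, f x ∈ S) ∧ #S = k ∧ MeetsDemands G (2 * M) S r ∧ (∀ w, r w ≤ d) ∧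
        (∀ w, w ∉ S → r w = d) ∧ ∀ x, d ≤ r (f x) + deg T x := by
  induction k with
  | zero =>
    intro W _ T _ hW _ _ root
    have : Nonempty W := ⟨root⟩
    exact absurd hW Nat.card_pos.ne'
  | succ k ih =>
    intro W _ T hT hW hN hdeg root
    rcases Nat.eq_zero_or_pos k with rfl | hk
    · have hsub : Subsingleton W := (Nat.card_eq_one_iff_unique.1 (by simpa using hW)).1
      refine ⟨fun _ => v, {v}, fun _ => d, fun x y _ => Subsingleton.elim _ _, rfl, ?_,
        by simp, by simp, ?_, fun _ => le_rfl, fun _ _ => rfl, fun _ => by simp⟩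
      · intro x y hxy
        exact absurd (Subsingleton.elim x y) hxy.ne
      · intro X hX
        rcases X.eq_empty_or_nonempty with rfl | hne
        · simp
        · have h1 := hsmall X hne hX
          have h2 := le_card_sdiff {v} (allNbrs G X)
          rw [sum_const, smul_eq_mul, mul_comm]
          simp only [card_singleton] at h2
          omega
    · have hnt : Nontrivial W := Finite.one_lt_card_iff_nontrivial.1 (by omega)
      have hfin := Fintype.ofFinite W
      classical
      obtain ⟨u, hur, hu⟩ : ∃ u, u ≠ root ∧ T.degree u = 1 := by
        obtain ⟨a, b, hab, ha, hb⟩ := hT.exists_ne_and_degree_eq_one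
        by_cases h : a = root
        · exact ⟨b, fun hbr => hab (h.trans hbr.symm), hb⟩
        · exact ⟨a, h, ha⟩
      have hT' : (T.induce ({u}ᶜ : Set W)).IsTree :=
        ⟨hT.1.induce_compl_singleton_of_degree_eq_one hu, hT.2.induce _⟩
      obtain ⟨p, hp, hpu⟩ := (T.degree_eq_one_iff_existsUnique_adj).1 hu
      have hpne : p ∈ ({u}ᶜ : Set W) := by simpa using hp.ne'
      have hdegle : ∀ x : ({u}ᶜ : Set W), deg (T.induce ({u}ᶜ : Set W)) x ≤ deg T x := by
        intro x
        refine Set.ncard_le_ncard_of_injOn (fun y => (y : W)) (fun y hy => by simpa using hy)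
          (fun a _ b _ h => Subtype.ext h) (Set.toFinite _)
      have hdegp : deg (T.induce ({u}ᶜ : Set W)) ⟨p, hpne⟩ + 1 ≤ deg T p := by
        have h1 : ((fun y : ({u}ᶜ : Set W) => (y : W)) ''
            ((T.induce ({u}ᶜ : Set W)).neighborSet ⟨p, hpne⟩)) ⊆ T.neighborSet p \ {u} := by
          rintro _ ⟨y, hy, rfl⟩
          exact ⟨by simpa using hy, y.2⟩
        have h2 := Set.ncard_le_ncard h1 (Set.toFinite _)
        rw [Set.ncard_image_of_injective _ Subtype.val_injective] at h2
        have h3 := Set.ncard_sdiff_singleton_add_one (s := T.neighborSet p) (a := u) hp.symm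
          (Set.toFinite _)
        unfold deg
        omega
      have hcard : Nat.card ({u}ᶜ : Set W) = k := by
        have := Set.ncard_add_ncard_compl ({u} : Set W)
        rw [Set.ncard_singleton] at this
        rw [Nat.card_coe_set_eq]
        omega
      obtain ⟨f, S, r, hinj, hroot, hadj, hfS, hSk, hgood, hrd, hrS, hdem⟩ :=
        ih ({u}ᶜ : Set W) (T.induce ({u}ᶜ : Set W)) hT' hcard (by omega)
          (fun x => (hdegle x).trans (hdeg x)) ⟨root, hur.symm⟩
      have hrp : 1 ≤ r (f ⟨p, hpne⟩) := by
        have h1 := hdem ⟨p, hpne⟩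
        have h2 := hdeg p
        omega
      obtain ⟨w, hwS, hw, hgood'⟩ := hgood.exists_extension hM hlarge hrd (by omega) hrp
      have hfw : ∀ x, f x ≠ w := fun x h => hwS (h ▸ hfS x)
      have hdegu : deg T u = 1 := by
        rw [deg, ← hu, ← T.card_neighborSet_eq_degree, Set.ncard_eq_toFinset_card',
          Set.toFinset_card]
      refine ⟨fun x => if h : x = u then w else f ⟨x, h⟩, insert w S, _, ?_, ?_, ?_, ?_, ?_,
        hgood', ?_, ?_, ?_⟩
      · intro x y hxy
        by_cases hx : x = u <;> by_cases hy : y = u <;> simp only [hx, hy, dite_true, dite_false]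
          at hxy ⊢
        · exact absurd hxy.symm (hfw _)
        · exact absurd hxy (hfw _)
        · exact congrArg Subtype.val (hinj hxy)
      · simp [hur.symm, hroot]
      · intro x y hxy
        by_cases hx : x = u <;> by_cases hy : y = u
        · exact absurd (hx.trans hy.symm) hxy.ne
        · subst hx
          obtain rfl := hpu y hxy
          simpa [hy] using hw.symm
        · subst hy
          obtain rfl := hpu x hxy.symm
          simpa [hx] using hw
        · simpa [hx, hy] using hadj ⟨x, hx⟩ ⟨y, hy⟩ hxy
      · intro x
        by_cases hx : x = u
        · simp [hx]
        · simp [hx, hfS]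
      · rw [card_insert_of_notMem hwS, hSk]
      · intro x
        have := hrd x
        split_ifs <;> omega
      · intro x hx
        rw [mem_insert, not_or] at hx
        have hxf : x ≠ f ⟨p, hpne⟩ := fun h => hx.2 (h ▸ hfS _)
        simp [hx.1, hxf, hrS x hx.2]
      · intro x
        by_cases hx : x = u
        · have := hrS w hwS
          simp [hx, hdegu, this]
          omega
        · by_cases hxp : x = p
          · subst hxp
            have := hdem ⟨x, hpne⟩
            simp [hx]
            omega
          · have h1 := hdem ⟨x, hx⟩
            have h2 := hdegle ⟨x, hx⟩
            have h3 : f ⟨x, hx⟩ ≠ f ⟨p, hpne⟩ := fun h => hxp (congrArg Subtype.val (hinj h))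
            simp only [hx, dite_false, h3, hfw, or_self, if_false]
            exact h1.trans (by simpa using h2)

end TreeEmbedding

section Core

open Finset

variable {V : Type*} {G : SimpleGraph V}

/-- The number of neighbours of `v` in `A`. -/
noncomputable def degIn (G : SimpleGraph V) (A : Finset V) (v : V) : ℕ := by
  classical exact #(A.filter (G.Adj v))

lemma degIn_mono {A B : Finset V} (h : A ⊆ B) (v : V) : degIn G A v ≤ degIn G B v := by
  classical exact card_le_card (filter_subset_filter _ h)

variable [DecidableEq V]

lemma degIn_eq_degIn_erase_add {A : Finset V} {v : V} (hv : v ∈ A) (b : V) [Decidable (G.Adj b v)] :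
    degIn G A b = degIn G (A.erase v) b + if G.Adj b v then 1 else 0 := by
  classical
  conv_lhs => rw [← insert_erase hv]
  unfold degIn
  rw [filter_insert]
  split_ifs with h
  · rw [card_insert_of_notMem (by simp)]
  · rfl

/-- Repeatedly deleting vertices of degree less than `L` from `A` leaves a set `C` spanning minimum
degree at least `L`, and the deleted vertices have few neighbours in `A` on average. -/
lemma exists_core (G : SimpleGraph V) (L : ℝ) (A : Finset V) :
    ∃ C ⊆ A, (∀ v ∈ C, L ≤ degIn G C v) ∧
      ∀ B ⊆ A \ C, ∑ b ∈ B, (degIn G A b : ℝ) ≤ L * (#(A \ C) + #B) := by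
  classical
  induction A using Finset.strongInduction with
  | H A ih =>
    by_cases hA : ∀ v ∈ A, L ≤ degIn G A v
    · refine ⟨A, Subset.rfl, hA, fun B hB => ?_⟩
      have : B = ∅ := by simpa using hB
      simp [this]
    · push Not at hA
      obtain ⟨v, hv, hlt⟩ := hA
      obtain ⟨C, hCA, hC, hsum⟩ := ih (A.erase v) (erase_ssubset hv)
      refine ⟨C, hCA.trans (erase_subset _ _), hC, fun B hB => ?_⟩
      have hvC : v ∉ C := fun h => by simpa using hCA h
      have hcard : #(A \ C) = #(A.erase v \ C) + 1 := by
        rw [erase_sdiff_comm, card_erase_add_one (by simp [hv, hvC])]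
      have hB' : B.erase v ⊆ A.erase v \ C := by
        rw [erase_sdiff_comm]
        exact erase_subset_erase _ hB
      have h1 := hsum _ hB'
      have h2 : ∑ b ∈ B.erase v, (degIn G A b : ℝ) =
          ∑ b ∈ B.erase v, (degIn G (A.erase v) b : ℝ) +
            #((B.erase v).filter fun b => G.Adj b v) := by
        rw [card_filter, Nat.cast_sum, ← sum_add_distrib]
        refine sum_congr rfl fun b _ => ?_
        rw [degIn_eq_degIn_erase_add hv b]
        push_cast
        rfl
      have h3 : (#((B.erase v).filter fun b => G.Adj b v) : ℝ) ≤ degIn G A v := by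
        unfold degIn
        norm_cast
        refine card_le_card fun b hb => ?_
        simp only [mem_filter, mem_erase] at hb ⊢
        exact ⟨(mem_sdiff.1 (hB hb.1.2)).1, hb.2.symm⟩
      rw [hcard]
      push_cast
      by_cases hvB : v ∈ B
      · have h4 := add_sum_erase B (fun b => (degIn G A b : ℝ)) hvB
        have h5 : (#B : ℝ) = #(B.erase v) + 1 := by
          rw [← card_erase_add_one hvB]
          push_cast
          rfl
        rw [h5]
        linarith
      · rw [erase_eq_of_notMem hvB] at h1 h2 h3
        linarith

/-- If most vertices of `X` have many neighbours in `Z`, then most of `X` survives in a subset of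
`X ∪ Z` of large minimum degree. -/
lemma exists_core_union {L : ℝ} (hL : 0 < L) (X Z : Finset V)
    [DecidablePred fun v => (degIn G Z v : ℝ) < 6 * L] :
    ∃ C ⊆ X ∪ Z, (∀ v ∈ C, L ≤ degIn G C v) ∧
      (#(X \ C) : ℝ) ≤ #Z / 4 + 5 / 4 * #{v ∈ X | (degIn G Z v : ℝ) < 6 * L} := by
  obtain ⟨C, hCA, hC, hsum⟩ := exists_core G L (X ∪ Z)
  refine ⟨C, hCA, hC, ?_⟩
  set bad := {v ∈ X | (degIn G Z v : ℝ) < 6 * L}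
  set B := (X \ C) \ bad
  have h1 := hsum B (by
    refine sdiff_subset.trans (sdiff_subset_sdiff subset_union_left Subset.rfl))
  have h2 : #B • (6 * L) ≤ ∑ b ∈ B, (degIn G (X ∪ Z) b : ℝ) := by
    refine card_nsmul_le_sum _ _ _ fun b hb => ?_
    have hb1 : ¬ (degIn G Z b : ℝ) < 6 * L := by
      intro h
      simp only [B, bad, mem_sdiff, mem_filter] at hb
      exact hb.2 ⟨hb.1.1, h⟩
    exact (not_lt.1 hb1).trans (mod_cast degIn_mono subset_union_right b)
  have h3 : (#((X ∪ Z) \ C) : ℝ) ≤ #(X \ C) + #Z := by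
    rw [union_sdiff_distrib]
    exact_mod_cast (card_union_le _ _).trans (by gcongr; exact sdiff_subset)
  have h4 : (#(X \ C) : ℝ) ≤ #B + #bad := by
    have : #(X \ C) - #bad ≤ #B := le_card_sdiff bad (X \ C)
    norm_cast
    omega
  rw [nsmul_eq_mul] at h2
  have h5 : (#B : ℝ) * 6 ≤ #((X ∪ Z) \ C) + #B := by
    refine le_of_mul_le_mul_right ?_ hL
    linarith
  linarith

end Core

section RandomSubset

open Finset

variable {V : Type*} [Fintype V] [DecidableEq V] {G : SimpleGraph V}

/-- The probability that the binomial random subset of density `p` equals `Z`. -/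
noncomputable def binomialWeight (p : ℝ) (Z : Finset V) : ℝ :=
  (∏ _i ∈ Z, p) * ∏ _i ∈ univ \ Z, (1 - p)

lemma binomialWeight_nonneg {p : ℝ} (hp : 0 ≤ p) (hp1 : p ≤ 1) (Z : Finset V) :
    0 ≤ binomialWeight p Z :=
  mul_nonneg (prod_nonneg fun _ _ => hp) (prod_nonneg fun _ _ => sub_nonneg.2 hp1)

lemma sum_binomialWeight_mul_prod (p : ℝ) (a : V → ℝ) :
    ∑ Z : Finset V, binomialWeight p Z * ∏ i ∈ Z, a i = ∏ i, (p * a i + (1 - p)) := by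
  rw [prod_add, powerset_univ]
  refine sum_congr rfl fun Z _ => ?_
  rw [binomialWeight, prod_mul_distrib]
  ring

lemma sum_binomialWeight (p : ℝ) : ∑ Z : Finset V, binomialWeight p Z = 1 := by
  simpa using sum_binomialWeight_mul_prod p (fun _ : V => 1)

lemma sum_binomialWeight_mul_card (p : ℝ) :
    ∑ Z : Finset V, binomialWeight p Z * #Z = p * Fintype.card V := by
  have h1 : ∀ v : V, ∑ Z : Finset V, binomialWeight p Z * (if v ∈ Z then 1 else 0) = p := by
    intro v
    have h2 := sum_binomialWeight_mul_prod p (fun i => if i = v then 0 else 1)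
    have h3 : ∏ i : V, (p * (if i = v then 0 else 1) + (1 - p)) = 1 - p := by
      rw [Fintype.prod_eq_single v]
      · simp
      · intro x hx
        simp [hx]
    rw [h3] at h2
    have h4 : ∀ Z : Finset V, binomialWeight p Z * (if v ∈ Z then (1 : ℝ) else 0) =
        binomialWeight p Z - binomialWeight p Z * ∏ i ∈ Z, (if i = v then (0 : ℝ) else 1) := by
      intro Z
      by_cases hv : v ∈ Z
      · rw [prod_eq_zero hv (by simp)]
        simp [hv]
      · rw [prod_eq_one]
        · simp [hv]
        · intro i hi
          rw [if_neg]
          rintro rfl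
          exact hv hi
    rw [sum_congr rfl fun Z _ => h4 Z, sum_sub_distrib, h2, sum_binomialWeight]
    ring
  have h5 : ∀ Z : Finset V, (#Z : ℝ) = ∑ v : V, if v ∈ Z then 1 else 0 := by
    intro Z
    simp
  simp_rw [h5, mul_sum]
  rw [sum_comm]
  rw [sum_congr rfl fun v _ => h1 v]
  simp [mul_comm]

/-- A lower-tail Chernoff bound for the degree into the binomial random subset. -/
lemma sum_binomialWeight_degIn_lt_le {p D : ℝ} (hp : 0 ≤ p) (hp1 : p ≤ 1) {δ : ℕ} {v : V}
    (hδ : δ ≤ degIn G univ v) [DecidablePred fun Z : Finset V => (degIn G Z v : ℝ) < D] :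
    ∑ Z : Finset V, binomialWeight p Z * (if (degIn G Z v : ℝ) < D then 1 else 0) ≤
      (4 : ℝ) ^ D * Real.exp (-(3 / 4 * p * δ)) := by
  classical
  have h1 : ∀ Z : Finset V, binomialWeight p Z * (if (degIn G Z v : ℝ) < D then 1 else 0) ≤
      (4 : ℝ) ^ D * (binomialWeight p Z * ∏ i ∈ Z, if G.Adj v i then (1 / 4 : ℝ) else 1) := by
    intro Z
    rw [mul_left_comm]
    refine mul_le_mul_of_nonneg_left ?_ (binomialWeight_nonneg hp hp1 Z)
    rw [prod_ite, prod_const_one, prod_const, mul_one]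
    split_ifs with h
    · have h2 : (4 : ℝ) ^ (degIn G Z v : ℝ) ≤ 4 ^ D :=
        Real.rpow_le_rpow_of_exponent_le (by norm_num) h.le
      rw [Real.rpow_natCast] at h2
      rw [one_div, inv_pow, ← div_eq_mul_inv, one_le_div (by positivity)]
      have h3 : #(Z.filter (G.Adj v)) = degIn G Z v := by
        unfold degIn
        congr
      rwa [h3]
    · positivity
  refine (sum_le_sum fun Z _ => h1 Z).trans ?_
  rw [← mul_sum, sum_binomialWeight_mul_prod]
  refine mul_le_mul_of_nonneg_left ?_ (by positivity)
  have h3 : ∀ i : V, p * (if G.Adj v i then (1 / 4 : ℝ) else 1) + (1 - p) =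
      if G.Adj v i then 1 - 3 / 4 * p else 1 := by
    intro i
    split_ifs <;> ring
  simp_rw [h3]
  rw [prod_ite, prod_const_one, prod_const, mul_one]
  have h4 : #(univ.filter (G.Adj v)) = degIn G univ v := by
    unfold degIn
    congr
  rw [h4]
  calc (1 - 3 / 4 * p) ^ degIn G univ v ≤ (1 - 3 / 4 * p) ^ δ :=
        pow_le_pow_of_le_one (by linarith) (by linarith) hδ
    _ ≤ Real.exp (-(3 / 4 * p)) ^ δ := by
        refine pow_le_pow_left₀ (by linarith) ?_ _
        have := Real.add_one_le_exp (-(3 / 4 * p))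
        linarith
    _ = Real.exp (-(3 / 4 * p * δ)) := by
        rw [← Real.exp_nat_mul]
        congr 1
        ring

lemma sum_binomialWeight_card_filter_le {p D q : ℝ} (hp : 0 ≤ p) (hp1 : p ≤ 1) {δ : ℕ}
    (hδ : ∀ v, δ ≤ degIn G univ v) (hq : (4 : ℝ) ^ D * Real.exp (-(3 / 4 * p * δ)) ≤ q)
    (X : Finset V) [∀ Z : Finset V, DecidablePred fun v => (degIn G Z v : ℝ) < D] :
    ∑ Z : Finset V, binomialWeight p Z * #{v ∈ X | (degIn G Z v : ℝ) < D} ≤ q * #X := by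
  classical
  simp_rw [card_filter, Nat.cast_sum, mul_sum]
  rw [sum_comm]
  have : ∑ _v ∈ X, q = q * #X := by simp [mul_comm]
  rw [← this]
  refine sum_le_sum fun v _ => ?_
  push_cast
  exact (sum_binomialWeight_degIn_lt_le hp hp1 (hδ v)).trans hq

/-- There is a small set in which most vertices of `X` and of `Y` have large degree. -/
lemma exists_sampling_set {p D q z β : ℝ} (hp : 0 ≤ p) (hp1 : p ≤ 1) {δ : ℕ}
    (hδ : ∀ v, δ ≤ degIn G univ v) (hq : (4 : ℝ) ^ D * Real.exp (-(3 / 4 * p * δ)) ≤ q)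
    (hz : 0 < z) (hβ : 0 < β) (hlt : p * Fintype.card V / z + 2 * q / β < 1)
    {X Y : Finset V} (hX : X.Nonempty) (hY : Y.Nonempty)
    [∀ Z : Finset V, DecidablePred fun v => (degIn G Z v : ℝ) < D] :
    ∃ Z : Finset V, (#Z : ℝ) < z ∧ (#{v ∈ X | (degIn G Z v : ℝ) < D} : ℝ) < β * #X ∧
      (#{v ∈ Y | (degIn G Z v : ℝ) < D} : ℝ) < β * #Y := by
  have hX0 : (0 : ℝ) < #X := mod_cast hX.card_pos
  have hY0 : (0 : ℝ) < #Y := mod_cast hY.card_pos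
  by_contra! hcon
  set F : Finset V → ℝ := fun Z => #Z / z + #{v ∈ X | (degIn G Z v : ℝ) < D} / (β * #X) +
    #{v ∈ Y | (degIn G Z v : ℝ) < D} / (β * #Y) with hF
  have hF1 : ∀ Z, 1 ≤ F Z := by
    intro Z
    have h1 : (0 : ℝ) ≤ #Z / z := by positivity
    have h2 : (0 : ℝ) ≤ #{v ∈ X | (degIn G Z v : ℝ) < D} / (β * #X) := by positivity
    have h3 : (0 : ℝ) ≤ #{v ∈ Y | (degIn G Z v : ℝ) < D} / (β * #Y) := by positivity
    simp only [hF]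
    rcases le_or_gt z #Z with h | h
    · have := (one_le_div hz).2 h
      linarith
    · rcases le_or_gt (β * #X) #{v ∈ X | (degIn G Z v : ℝ) < D} with h' | h'
      · have := (one_le_div (by positivity)).2 h'
        linarith
      · have := (one_le_div (by positivity)).2 (hcon Z h h')
        linarith
  have h1 : 1 ≤ ∑ Z : Finset V, binomialWeight p Z * F Z := by
    rw [← sum_binomialWeight (V := V) p]
    refine sum_le_sum fun Z _ => ?_
    exact le_mul_of_one_le_right (binomialWeight_nonneg hp hp1 Z) (hF1 Z)
  have h2 : ∑ Z : Finset V, binomialWeight p Z * F Z =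
      (∑ Z : Finset V, binomialWeight p Z * #Z) / z +
      (∑ Z : Finset V, binomialWeight p Z * #{v ∈ X | (degIn G Z v : ℝ) < D}) / (β * #X) +
      (∑ Z : Finset V, binomialWeight p Z * #{v ∈ Y | (degIn G Z v : ℝ) < D}) / (β * #Y) := by
    rw [sum_div, sum_div, sum_div, ← sum_add_distrib, ← sum_add_distrib]
    refine sum_congr rfl fun Z _ => ?_
    simp only [hF]
    ring
  have h3 : (∑ Z : Finset V, binomialWeight p Z * #{v ∈ X | (degIn G Z v : ℝ) < D}) / (β * #X) ≤
      q / β := by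
    rw [div_le_div_iff₀ (by positivity) hβ]
    have := mul_le_mul_of_nonneg_left (sum_binomialWeight_card_filter_le hp hp1 hδ hq X) hβ.le
    linarith
  have h4 : (∑ Z : Finset V, binomialWeight p Z * #{v ∈ Y | (degIn G Z v : ℝ) < D}) / (β * #Y) ≤
      q / β := by
    rw [div_le_div_iff₀ (by positivity) hβ]
    have := mul_le_mul_of_nonneg_left (sum_binomialWeight_card_filter_le hp hp1 hδ hq Y) hβ.le
    linarith
  rw [sum_binomialWeight_mul_card] at h2
  have h5 : 2 * q / β = q / β + q / β := by ring
  linarith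

end RandomSubset

section Expansion

open Finset

variable {V : Type*} [Fintype V] [DecidableEq V] {G : SimpleGraph V}

/-- Every induced subgraph of minimum degree at least `L` is a `(1/(2d+2), d+1)`-expander. -/
def HasExpandingCores (G : SimpleGraph V) (L : ℝ) (d : ℕ) : Prop :=
  ∀ U X : Finset V, X ⊆ U → (∀ v ∈ U, L ≤ degIn G U v) → (2 * d + 2) * #X ≤ #U →
    (d + 1) * #X ≤ #(allNbrs G X ∩ (U \ X))

/-- Two disjoint large vertex sets are joined by an edge. -/
lemma HasExpandingCores.exists_adj {L ξ : ℝ} {d δ : ℕ} (hexp : HasExpandingCores G L d)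
    (hd : 2 ≤ d) (hL : 0 < L) (hδ : ∀ v, δ ≤ degIn G univ v) (hξ : ξ ≤ 1 / 2)
    (hq : (4 : ℝ) ^ (6 * L) * Real.exp (-(3 / 4 * (6 / 5 * ξ) * δ)) ≤ 1 / 128)
    (hn : 2 * d + 1 ≤ ξ * Fintype.card V) {X Y : Finset V} (hXY : Disjoint X Y)
    (hX : ξ * Fintype.card V ≤ #X) (hX' : (#X : ℝ) ≤ ξ * Fintype.card V + 1)
    (hY : 3 * (d + 1) * (ξ * Fintype.card V) ≤ #Y) : ∃ x ∈ X, ∃ y ∈ Y, G.Adj x y := by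
  classical
  by_contra! hno
  have hd' : (2 : ℝ) ≤ d := mod_cast hd
  set t := ξ * Fintype.card V with ht
  have ht0 : 0 < t := by linarith
  have hξ0 : 0 < ξ := pos_of_mul_pos_left ht0 (Nat.cast_nonneg _)
  have hX0 : X.Nonempty := by
    rw [← card_pos]
    exact_mod_cast ht0.trans_le hX
  have hY0 : Y.Nonempty := by
    rw [← card_pos]
    have : (0 : ℝ) < #Y := lt_of_lt_of_le (by positivity) hY
    exact_mod_cast this
  obtain ⟨Z, hZ, hbX, hbY⟩ := exists_sampling_set (G := G) (p := 6 / 5 * ξ) (D := 6 * L)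
    (z := 3 / 2 * t) (β := 8 / 100) (by positivity) (by linarith) hδ hq (by positivity)
    (by norm_num) (by
      have : 6 / 5 * ξ * Fintype.card V / (3 / 2 * t) = 4 / 5 := by
        rw [div_eq_iff (by positivity), ht]
        ring
      rw [this]
      norm_num) hX0 hY0
  obtain ⟨C, hCA, hC, hXC⟩ := exists_core_union (G := G) hL X Z
  obtain ⟨E, hEA, hE, hYE⟩ := exists_core_union (G := G) hL Y Z
  have hU : ∀ v ∈ C ∪ E, L ≤ degIn G (C ∪ E) v := by
    intro v hv
    rcases mem_union.1 hv with h | h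
    · exact (hC v h).trans (mod_cast degIn_mono subset_union_left v)
    · exact (hE v h).trans (mod_cast degIn_mono subset_union_right v)
  have hA1 : (#(X ∩ C) : ℝ) + #(X \ C) = #X := mod_cast card_inter_add_card_sdiff X C
  have hA2 : (#(Y ∩ E) : ℝ) + #(Y \ E) = #Y := mod_cast card_inter_add_card_sdiff Y E
  set P := X ∩ (C ∪ E) with hP
  have hP1 : (#(X ∩ C) : ℝ) ≤ #P :=
    mod_cast card_le_card (inter_subset_inter Subset.rfl subset_union_left)
  have hP2 : (#P : ℝ) ≤ #X := mod_cast card_le_card inter_subset_left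
  have hYE' : (2 * d + 1 : ℝ) * #P ≤ #(Y ∩ E) := by
    have h1 : (2 * d + 1 : ℝ) * #P ≤ (2 * d + 1) * (t + 1) := by gcongr; linarith
    have h2 : (2 * d + 1 : ℝ) * (t + 1) ≤ 2 * (d + 1) * t := by linarith
    have h3 : 2 * t ≤ d * t := by gcongr
    linarith
  have hcardU : (2 * d + 2) * #P ≤ #(C ∪ E) := by
    have h1 : P ∪ (Y ∩ E) ⊆ C ∪ E := union_subset inter_subset_right
      (inter_subset_right.trans subset_union_right)
    have h2 := card_le_card h1
    rw [card_union_of_disjoint (hXY.mono inter_subset_left inter_subset_left)] at h2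
    have h3 : (2 * d + 1) * #P ≤ #(Y ∩ E) := mod_cast hYE'
    linarith
  have hexpand := hexp (C ∪ E) P inter_subset_right hU hcardU
  have hsub : allNbrs G P ∩ ((C ∪ E) \ P) ⊆ Z := by
    intro w hw
    simp only [mem_inter, mem_sdiff, mem_allNbrs, hP] at hw
    obtain ⟨⟨x, hx, hxw⟩, hwU, hwX⟩ := hw
    have hwX' : w ∉ X := fun h => hwX ⟨h, hwU⟩
    have hwY : w ∉ Y := fun h => hno x hx.1 w h hxw
    rcases mem_union.1 hwU with h | h
    · exact (mem_union.1 (hCA h)).resolve_left hwX'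
    · exact (mem_union.1 (hEA h)).resolve_left hwY
  have hfin : ((d + 1 : ℕ) : ℝ) * #P ≤ #Z := mod_cast hexpand.trans (card_le_card hsub)
  push_cast at hfin
  have h1 : 0.525 * (#X : ℝ) ≤ #P := by linarith
  have h2 : (3 : ℝ) * #P ≤ (d + 1) * #P := by gcongr; linarith
  linarith

/-- If all cores expand and `L ≤ 1`, then `G` has few vertices in terms of its maximum degree. -/
lemma HasExpandingCores.card_le {L : ℝ} {d D : ℕ} (hexp : HasExpandingCores G L d)
    (hL : L ≤ 1) (hpos : ∀ v, 0 < degIn G univ v) (hD : ∀ v, degIn G univ v ≤ D) :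
    Fintype.card V ≤ 2 * D + 2 * D * D + 4 * d + 4 := by
  classical
  by_contra! hcard
  have hNcard : ∀ A : Finset V, #(allNbrs G A) ≤ #A * D := by
    intro A
    have : allNbrs G A = A.biUnion fun a => univ.filter (G.Adj a) := by
      ext w; simp [mem_allNbrs]
    rw [this]
    refine card_biUnion_le_card_mul _ _ _ fun a _ => ?_
    convert hD a
    unfold degIn
    congr
  have hV : Nonempty V := Fintype.card_pos_iff.1 (by omega)
  have hnbr : ∀ v, ∃ w, G.Adj v w := by
    intro v
    obtain ⟨w, hw⟩ := card_pos.1 (hpos v)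
    exact ⟨w, by simpa using hw⟩
  obtain ⟨a⟩ := hV
  obtain ⟨b, hab⟩ := hnbr a
  set Q := allNbrs G {a, b} with hQ
  have hQcard : #Q ≤ 2 * D := (hNcard _).trans (by gcongr; exact card_le_two)
  have hQcard' : #(allNbrs G Q) ≤ 2 * D * D := (hNcard _).trans (by gcongr)
  have haQ : a ∈ Q := mem_allNbrs.2 ⟨b, by simp, hab.symm⟩
  have hbQ : b ∈ Q := mem_allNbrs.2 ⟨a, by simp, hab⟩
  set W := univ.filter fun v => v ∉ Q ∧ ∃ w, w ∉ Q ∧ G.Adj v w with hW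
  have hWcard : Fintype.card V ≤ #Q + #(allNbrs G Q) + #W := by
    rw [← card_univ]
    refine (card_le_card (t := Q ∪ allNbrs G Q ∪ W) fun v _ => ?_).trans
      ((card_union_le _ _).trans (by gcongr; exact card_union_le _ _))
    by_cases hv : v ∈ Q
    · simp [hv]
    · by_cases hv' : v ∈ allNbrs G Q
      · simp [hv']
      · obtain ⟨w, hw⟩ := hnbr v
        have hwQ : w ∉ Q := fun h => hv' (mem_allNbrs.2 ⟨w, h, hw.symm⟩)
        exact mem_union_right _ (by simpa [hW] using ⟨hv, w, hwQ, hw⟩)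
  have hmin : ∀ v ∈ {a, b} ∪ W, L ≤ degIn G ({a, b} ∪ W) v := by
    intro v hv
    suffices h : ∃ w ∈ {a, b} ∪ W, G.Adj v w by
      obtain ⟨w, hw, hvw⟩ := h
      have h1 : 0 < degIn G ({a, b} ∪ W) v := card_pos.2 ⟨w, mem_filter.2 ⟨hw, hvw⟩⟩
      have h2 : (1 : ℝ) ≤ degIn G ({a, b} ∪ W) v := mod_cast h1
      exact hL.trans h2
    rcases mem_union.1 hv with h | h
    · rcases mem_insert.1 h with rfl | h
      · exact ⟨b, by simp, hab⟩
      · obtain rfl := mem_singleton.1 h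
        exact ⟨a, by simp, hab.symm⟩
    · obtain ⟨-, hvQ, w, hwQ, hvw⟩ := mem_filter.1 h
      exact ⟨w, mem_union_right _ (mem_filter.2 ⟨mem_univ _, hwQ, v, hvQ, hvw.symm⟩), hvw⟩
  have h1 := hexp ({a, b} ∪ W) {a, b} subset_union_left hmin (by
    rw [card_pair hab.ne]
    have := card_le_card (subset_union_right (s₁ := {a, b}) (s₂ := W))
    omega)
  have h2 : allNbrs G {a, b} ∩ (({a, b} ∪ W) \ {a, b}) = ∅ := by
    rw [← disjoint_iff_inter_eq_empty, Finset.disjoint_left]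
    intro w hw hw'
    obtain ⟨hw1, hw2⟩ := mem_sdiff.1 hw'
    exact (mem_filter.1 ((mem_union.1 hw1).resolve_left hw2)).2.1 hw
  rw [h2, card_pair hab.ne, card_empty] at h1
  omega

/-- In a graph whose cores expand, rooted bounded degree trees leaving out a proportion `η` of the
vertices embed with an arbitrary image of the root. -/
lemma HasExpandingCores.exists_rooted_tree_embedding {L η : ℝ} {d δ : ℕ}
    (hexp : HasExpandingCores G L d) (hd : 2 ≤ d) (hη0 : 0 < η) (hη : η < 1 / 2) (hL : 0 < L)
    (hLδ : L ≤ δ) (hδ : ∀ v, δ ≤ degIn G univ v)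
    (hq : (4 : ℝ) ^ (6 * L) * Real.exp (-(3 / 4 * (6 / 5 * (η / (5 * (d + 1)))) * δ)) ≤ 1 / 128)
    (hn : 2 * d + 1 ≤ η / (5 * (d + 1)) * Fintype.card V) {W : Type} [Finite W]
    {T : SimpleGraph W} (hT : T.IsTree) (hdeg : ∀ x, deg T x ≤ d)
    (hW : (Nat.card W : ℝ) ≤ (1 - η) * Fintype.card V) (root : W) (v : V) :
    ∃ f : W → V, Function.Injective f ∧ f root = v ∧ ∀ x y, T.Adj x y → G.Adj (f x) (f y) := by
  have hd' : (2 : ℝ) ≤ d := mod_cast hd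
  set n : ℝ := (Fintype.card V : ℝ) with hn_def
  set ξ := η / (5 * (d + 1)) with hξ
  have hξη : (d + 1) * ξ = η / 5 := by
    rw [hξ]
    field_simp
  have hξ0 : 0 < ξ := by positivity
  have hξ1 : ξ ≤ 1 / 2 := by nlinarith
  have hn0 : 0 ≤ n := Nat.cast_nonneg _
  have hξn : (d + 1) * (ξ * n) = η / 5 * n := by rw [← mul_assoc, hξη]
  have hηn : η * n ≤ 1 / 2 * n := by gcongr
  set M := ⌊ξ * n⌋₊ with hM
  have hMle : (M : ℝ) ≤ ξ * n := Nat.floor_le (by positivity)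
  have hMlt : ξ * n < M + 1 := Nat.lt_floor_add_one _
  have hMd : (d + 1 : ℝ) * M ≤ η / 5 * n := by
    rw [← hξn]
    gcongr
  have hM1 : 1 ≤ M := by
    rw [hM, Nat.one_le_floor_iff]
    linarith
  have hsmall : ∀ X : Finset V, X.Nonempty → #X ≤ 2 * M → d * #X + 1 ≤ #(allNbrs G X) := by
    intro X hX hX2
    have h1 : ((2 * d + 2) * #X : ℝ) ≤ n := by
      have : (#X : ℝ) ≤ 2 * M := mod_cast hX2
      have : ((2 * d + 2) * #X : ℝ) ≤ (2 * d + 2) * (2 * M) := by gcongr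
      linarith
    have h2 := hexp univ X (subset_univ _) (fun v _ => hLδ.trans (mod_cast hδ v)) (by
      rw [card_univ]
      rw [hn_def] at h1
      exact_mod_cast h1)
    have h3 := card_le_card (inter_subset_left (s₁ := allNbrs G X) (s₂ := univ \ X))
    have h4 := hX.card_pos
    linarith
  have hlarge : ∀ X : Finset V, M < #X → #X ≤ 2 * M →
      d * #X + ⌊(1 - η) * n⌋₊ ≤ #(allNbrs G X) := by
    intro X hX hX2
    obtain ⟨X', hX', hX'card⟩ := exists_subset_card_eq (n := M + 1) (s := X) hX
    have hX'r : (#X' : ℝ) = M + 1 := by exact_mod_cast hX'card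
    set Y := univ \ (X ∪ allNbrs G X) with hY
    have hYlt : (#Y : ℝ) < 3 * (d + 1) * (ξ * n) := by
      by_contra! hle
      obtain ⟨x, hx, y, hy, hxy⟩ := hexp.exists_adj (X := X') (Y := Y) hd hL hδ hξ1 hq hn
        ((disjoint_sdiff.mono_left subset_union_left).mono_left hX') (by linarith) (by linarith)
        hle
      exact (mem_sdiff.1 hy).2 (mem_union_right _ (mem_allNbrs.2 ⟨x, hX' hx, hxy⟩))
    have h1 : n ≤ #X + #(allNbrs G X) + #Y := by
      have h2 : #Y + _ = _ := card_sdiff_add_card_eq_card (subset_univ (X ∪ allNbrs G X))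
      have h3 := card_union_le X (allNbrs G X)
      rw [card_univ] at h2
      rw [hn_def]
      norm_cast
      omega
    have h2 : (d + 1 : ℝ) * #X ≤ 2 * (η / 5 * n) := by
      have : (#X : ℝ) ≤ 2 * M := mod_cast hX2
      have : ((d + 1) * #X : ℝ) ≤ (d + 1) * (2 * M) := by gcongr
      linarith
    have h3 : (⌊(1 - η) * n⌋₊ : ℝ) ≤ (1 - η) * n :=
      Nat.floor_le (mul_nonneg (by linarith) hn0)
    have h4 : (d * #X + ⌊(1 - η) * n⌋₊ : ℝ) ≤ #(allNbrs G X) := by linarith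
    exact_mod_cast h4
  obtain ⟨f, -, -, hinj, hroot, hadj, -⟩ := exists_tree_embedding_meetsDemands hM1 hsmall hlarge v
    (Nat.card W) W T hT rfl (Nat.le_floor hW) hdeg root
  exact ⟨f, hinj, hroot, hadj⟩

end Expansion

section Parameters

lemma log_two_div_ge {η : ℝ} (hη0 : 0 < η) (hη : η < 1 / 2) :
    2 * Real.log 2 ≤ Real.log (2 / η) := by
  have h1 : (2 : ℝ) ^ 2 ≤ 2 / η := by
    rw [le_div_iff₀ hη0]
    linarith
  have h2 := Real.log_le_log (by norm_num) h1
  rw [Real.log_pow] at h2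
  exact_mod_cast h2

lemma four_rpow_mul_exp_le {η L δ : ℝ} {d : ℕ} (hd : 2 ≤ d) (hη0 : 0 < η) (hη : η < 1 / 2)
    (hL : L = η * δ / (40 * d ^ 2 * Real.log (2 / η))) (hL1 : 1 ≤ L) :
    (4 : ℝ) ^ (6 * L) * Real.exp (-(3 / 4 * (6 / 5 * (η / (5 * (d + 1)))) * δ)) ≤ 1 / 128 := by
  have hd' : (2 : ℝ) ≤ d := mod_cast hd
  have hlog := log_two_div_ge hη0 hη
  have hlog2 : 0 < Real.log 2 := Real.log_pos (by norm_num)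
  set l := Real.log (2 / η)
  have hl : 0 < l := by linarith
  have hηδ : η * δ = 40 * d ^ 2 * l * L := by
    rw [hL]
    field_simp
  have h1 : 3 / 4 * (6 / 5 * (η / (5 * (d + 1)))) * δ =
      36 / 5 * (d ^ 2 / (d + 1)) * l * L := by
    have : 3 / 4 * (6 / 5 * (η / (5 * (d + 1)))) * δ = 9 / 50 * (η * δ) / (d + 1) := by
      field_simp
      ring
    rw [this, hηδ]
    ring
  have h2 : (4 / 3 : ℝ) ≤ d ^ 2 / (d + 1) := by
    rw [le_div_iff₀ (by positivity)]
    nlinarith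
  have h3 : 36 / 5 * (4 / 3) * (2 * Real.log 2) * L ≤ 36 / 5 * (d ^ 2 / (d + 1)) * l * L := by
    gcongr
  have h4 : (4 : ℝ) ^ (6 * L) = Real.exp (12 * L * Real.log 2) := by
    rw [Real.rpow_def_of_pos (by norm_num), show (4 : ℝ) = 2 ^ 2 by norm_num, Real.log_pow]
    congr 1
    push_cast
    ring
  have h5 : (1 / 128 : ℝ) = Real.exp (-(7 * Real.log 2)) := by
    rw [Real.exp_neg, show (7 : ℝ) * Real.log 2 = Real.log (2 ^ 7) by rw [Real.log_pow]; norm_num,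
      Real.exp_log (by norm_num)]
    norm_num
  rw [h1, h4, ← Real.exp_add, h5, Real.exp_le_exp]
  nlinarith

end Parameters

section Translation

variable {V : Type*} {G : SimpleGraph V}

lemma minDeg_le_deg (v : V) : minDeg G ≤ deg G v :=
  ciInf_le (OrderBot.bddBelow _) v

lemma deg_induce_eq_degIn (U : Finset V) (v : (U : Set V)) :
    deg (G.induce (U : Set V)) v = degIn G U v := by
  classical
  rw [deg, degIn, ← Set.ncard_image_of_injective _ Subtype.val_injective, ← Set.ncard_coe_finset]
  congr 1
  ext w
  simp [and_comm]

variable [Fintype V]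

lemma deg_eq_degIn_univ (v : V) : deg G v = degIn G Finset.univ v := by
  classical
  rw [deg, degIn, ← Set.ncard_coe_finset]
  congr 1
  ext w
  simp

lemma hasExpandingCores_of_isExpander [DecidableEq V] {L : ℝ} {d : ℕ}
    (h : ∀ s : Set V, (∀ v : s, L ≤ (deg (G.induce s) v : ℝ)) →
      IsExpander (G.induce s) s.ncard (1 / (2 * d + 2)) (d + 1)) :
    HasExpandingCores G L d := by
  intro U X hXU hU hcard
  have h1 := h U (fun v => by
    rw [deg_induce_eq_degIn]
    exact hU v v.2)
  have hX : (Subtype.val : ↥(U : Set V) → V) '' {x : (U : Set V) | x.1 ∈ X} = X := by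
    ext w
    simpa using fun hw => hXU hw
  have hXcard : Set.ncard {x : (U : Set V) | (x : V) ∈ X} = X.card := by
    rw [← Set.ncard_image_of_injective _ Subtype.val_injective, hX, Set.ncard_coe_finset]
  have h2 := h1 {x : (U : Set V) | x.1 ∈ X} (by
    rw [hXcard, Set.ncard_coe_finset, one_div, ← div_eq_inv_mul, le_div_iff₀ (by positivity),
      mul_comm]
    exact_mod_cast hcard)
  rw [hXcard] at h2
  refine h2.trans ?_
  rw [← Set.ncard_image_of_injective _ Subtype.val_injective, ← Set.ncard_coe_finset]
  refine Set.ncard_le_ncard ?_ (Set.toFinite _)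
  rintro _ ⟨w, ⟨hw1, x, hx, hwx⟩, rfl⟩
  simp only [Finset.coe_inter, Finset.coe_sdiff, Set.mem_inter_iff, Set.mem_sdiff, Finset.mem_coe,
    mem_allNbrs]
  exact ⟨⟨x, hx, hwx.symm⟩, w.2, hw1⟩

lemma deg_le_maxDeg (v : V) : deg G v ≤ maxDeg G :=
  le_ciSup (f := deg G) (Set.finite_range _).bddAbove v

end Translation

/-- For every integer `d ≥ 2` and real `η ∈ (0,1/2)` there is `n₀` such that
for all `n ≥ n₀`: if `G` is an `n`-vertex graph with `Δ(G) ≤ 10·δ(G)` in which every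
vertex-induced subgraph of minimum degree at least `ℓ₂(η,d,δ(G)) = η·δ(G)/(40d²·ln(2/η))` is
a `(1/(2d+2), d+1)`-expander, then for every vertex `v` of `G` and every rooted tree `T` on
at most `(1-η)n` vertices with maximum degree at most `d`, the graph `G` contains a copy of
`T` rooted at `v`. -/
theorem rooted_tree_embedding_in_expander (d : ℕ) (hd : 2 ≤ d)
    (η : ℝ) (hη : 0 < η ∧ η < 1 / 2) :
    ∃ n₀ : ℕ, ∀ n ≥ n₀, ∀ G : SimpleGraph (Fin n),
      maxDeg G ≤ 10 * minDeg G →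
      (∀ s : Set (Fin n),
        (∀ v : s, η * (minDeg G) / (40 * d ^ 2 * Real.log (2 / η)) ≤
          (deg (G.induce s) v : ℝ)) →
        IsExpander (G.induce s) s.ncard (1 / (2 * d + 2)) (d + 1)) →
      ∀ v : Fin n, ∀ m : ℕ, ∀ T : SimpleGraph (Fin m), T.IsTree →
        (∀ x, deg T x ≤ d) → (m : ℝ) ≤ (1 - η) * n →
        ∀ root : Fin m,
          ∃ f : Fin m → Fin n, Function.Injective f ∧ f root = v ∧
            ∀ x y, T.Adj x y → G.Adj (f x) (f y) := by
  obtain ⟨hη0, hη2⟩ := hη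
  have hd' : (2 : ℝ) ≤ d := mod_cast hd
  have hlog : 0 < Real.log (2 / η) := by
    have := log_two_div_ge hη0 hη2
    have := Real.log_pos (x := 2) (by norm_num)
    linarith
  set D := 10 * ⌈40 * d ^ 2 * Real.log (2 / η) / η⌉₊ with hD
  refine ⟨max ⌈(2 * d + 1) / (η / (5 * (d + 1)))⌉₊ (2 * D + 2 * D * D + 4 * d + 5), ?_⟩
  intro n hn G hΔ hind v m T hT hdeg hm root
  obtain ⟨hn1, hn2⟩ := max_le_iff.1 hn
  have hexp := hasExpandingCores_of_isExpander hind
  set L := η * (minDeg G) / (40 * d ^ 2 * Real.log (2 / η)) with hL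
  have hδ : ∀ u, minDeg G ≤ degIn G Finset.univ u := fun u =>
    deg_eq_degIn_univ (G := G) u ▸ minDeg_le_deg u
  rcases le_or_gt L 1 with hL1 | hL1
  · have hδD : 10 * minDeg G ≤ D := by
      rw [hD]
      gcongr
      rw [hL, div_le_one (by positivity)] at hL1
      have h1 : (minDeg G : ℝ) ≤ 40 * d ^ 2 * Real.log (2 / η) / η := by
        rw [le_div_iff₀ hη0]
        linarith
      exact_mod_cast h1.trans (Nat.le_ceil _)
    have hΔ' : ∀ u, degIn G Finset.univ u ≤ 10 * minDeg G := fun u =>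
      deg_eq_degIn_univ (G := G) u ▸ (deg_le_maxDeg u).trans hΔ
    have hpos : 0 < minDeg G := by
      by_contra! h0
      have h1 := hexp Finset.univ {v} (by simp) (fun u _ => by
        rw [hL, Nat.le_zero.1 h0]
        simp) (by
        rw [Finset.card_univ, Fintype.card_fin, Finset.card_singleton]
        omega)
      obtain ⟨w, hw⟩ := Finset.card_pos.1 (lt_of_lt_of_le (by simp) h1)
      have hvw : G.Adj v w := by simpa [mem_allNbrs] using (Finset.mem_inter.1 hw).1
      have h2 : 0 < degIn G Finset.univ v := Finset.card_pos.2 ⟨w, by simpa using hvw⟩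
      have h3 := hΔ' v
      omega
    have h1 := hexp.card_le hL1 (fun u => hpos.trans_le (hδ u)) (fun u => (hΔ' u).trans hδD)
    rw [Fintype.card_fin] at h1
    omega
  · refine hexp.exists_rooted_tree_embedding hd hη0 hη2 (by linarith) ?_ hδ
      (four_rpow_mul_exp_le hd hη0 hη2 hL hL1.le) ?_ hT hdeg ?_ root v
    · have h1 : 40 * d ^ 2 * Real.log (2 / η) ≥ 1 := by
        have h2 := log_two_div_ge hη0 hη2
        have h3 := Real.log_two_gt_d9
        nlinarith
      have h4 : (0 : ℝ) ≤ minDeg G := Nat.cast_nonneg _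
      rw [hL, div_le_iff₀ (by positivity)]
      nlinarith
    · rw [Fintype.card_fin, ← div_le_iff₀' (by positivity)]
      exact Nat.ceil_le.1 hn1
    · simpa using hm
end

section
/- Let H = (V,E) be a graph on n vertices with minimum degree k > 0. Then there exists a partition V = V₁ ∪ … ∪ V_t into pairwise disjoint nonempty parts such that, for every i ∈ [t], the induced subgraph H[V_i] is k²/(16n)-vertex-connected and |V_i| ≥ k/8. -/
/-- A graph `G` with `nv` vertices is `c`-(vertex-)connected, for a real `c > 0`, if it has
more than `c` vertices and the deletion of any set of fewer than `c` vertices leaves it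
connected. -/
def RealConnected {V : Type*} (G : SimpleGraph V) (nv : ℕ) (c : ℝ) : Prop :=
  c < nv ∧ ∀ s : Set V, (s.ncard : ℝ) < c → (G.induce sᶜ).Connected

section Helpers

open Finset

theorem SimpleGraph.card_interedges_eq_sum {V : Type*} (H : SimpleGraph V) [DecidableRel H.Adj]
    (A B : Finset V) :
    #(H.interedges A B) = ∑ v ∈ A, #{w ∈ B | H.Adj v w} := by
  rw [SimpleGraph.interedges, Rel.interedges, card_filter, sum_product]
  simp only [card_filter]

variable {V : Type*} [DecidableEq V] (H : SimpleGraph V)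

/-- A finite vertex set `C` is robustly connected, up to a real threshold `c`, if it has more than
`c` vertices and no two nonempty sides of it can be separated by fewer than `c` vertices. -/
def RobustlyConnected (c : ℝ) (C : Finset V) : Prop :=
  c < #C ∧ ∀ S A B : Finset V, A ∪ B ∪ S = C → Disjoint A B → Disjoint A S → Disjoint B S →
    A.Nonempty → B.Nonempty → (#S : ℝ) < c → ∃ a ∈ A, ∃ b ∈ B, H.Adj a b

variable {H}

theorem RobustlyConnected.realConnected {c : ℝ} {C : Finset V} (h : RobustlyConnected H c C) :
    RealConnected (H.induce (C : Set V)) (C : Set V).ncard c := by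
  classical
  refine ⟨by simpa [Set.ncard_coe_finset] using h.1, fun s hs => ?_⟩
  set S : Finset V := s.toFinset.map (Function.Embedding.subtype _) with hS
  have hScard : (#S : ℝ) < c := by
    rwa [hS, card_map, ← Set.ncard_eq_toFinset_card']
  have hmem : ∀ x (hx : x ∈ (C : Set V)), x ∈ S ↔ (⟨x, hx⟩ : (C : Set V)) ∈ s := by
    intro x hx
    have hxC : x ∈ C := hx
    simp [hS, hxC]
  have hSC : ∀ x ∈ S, x ∈ C := by
    intro x hx
    obtain ⟨y, -, rfl⟩ := mem_map.1 hx
    exact y.2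
  have hne : ∃ x ∈ C, x ∉ S := by
    by_contra! hcon
    have hle : (#C : ℝ) ≤ #S := by exact_mod_cast card_le_card hcon
    linarith [h.1]
  obtain ⟨x, hxC, hxS⟩ := hne
  have : Nonempty (sᶜ : Set (C : Set V)) := ⟨⟨⟨x, hxC⟩, fun hx => hxS ((hmem x hxC).2 hx)⟩⟩
  refine SimpleGraph.Connected.mk fun u v => ?_
  by_contra huv
  let K := (H.induce (C : Set V)).induce sᶜ
  let A : Finset V := {x ∈ C | ∃ w : (sᶜ : Set (C : Set V)), w.1.1 = x ∧ K.Reachable u w}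
  let B : Finset V := {x ∈ C | ∃ w : (sᶜ : Set (C : Set V)), w.1.1 = x ∧ ¬ K.Reachable u w}
  have hAB : Disjoint A B := by
    rw [Finset.disjoint_left]
    rintro x hxA hxB
    obtain ⟨-, w, rfl, hw⟩ := mem_filter.1 hxA
    obtain ⟨-, w', hww, hw'⟩ := mem_filter.1 hxB
    rw [Subtype.ext (Subtype.ext hww)] at hw'
    exact hw' hw
  have hnotS : ∀ w : (sᶜ : Set (C : Set V)), w.1.1 ∉ S := fun w hw => w.2 ((hmem _ w.1.2).1 hw)
  have hcover : A ∪ B ∪ S = C := by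
    ext x
    simp only [mem_union]
    constructor
    · rintro ((hx | hx) | hx)
      · exact (mem_filter.1 hx).1
      · exact (mem_filter.1 hx).1
      · exact hSC x hx
    · intro hx
      by_cases hxS : x ∈ S
      · exact Or.inr hxS
      · let w : (sᶜ : Set (C : Set V)) := ⟨⟨x, hx⟩, fun hxs => hxS ((hmem x hx).2 hxs)⟩
        by_cases hr : K.Reachable u w
        · exact Or.inl (Or.inl (mem_filter.2 ⟨hx, w, rfl, hr⟩))
        · exact Or.inl (Or.inr (mem_filter.2 ⟨hx, w, rfl, hr⟩))
  have hAS : Disjoint A S := by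
    rw [Finset.disjoint_left]
    intro x hx
    obtain ⟨-, w, rfl, -⟩ := mem_filter.1 hx
    exact hnotS w
  have hBS : Disjoint B S := by
    rw [Finset.disjoint_left]
    intro x hx
    obtain ⟨-, w, rfl, -⟩ := mem_filter.1 hx
    exact hnotS w
  have hu : u.1.1 ∈ A := mem_filter.2 ⟨u.1.2, u, rfl, SimpleGraph.Reachable.refl u⟩
  have hv : v.1.1 ∈ B := mem_filter.2 ⟨v.1.2, v, rfl, huv⟩
  obtain ⟨a, ha, b, hb, hadj⟩ := h.2 S A B hcover hAB hAS hBS ⟨_, hu⟩ ⟨_, hv⟩ hScard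
  obtain ⟨-, w, rfl, hw⟩ := mem_filter.1 ha
  obtain ⟨-, w', rfl, hw'⟩ := mem_filter.1 hb
  have hK : K.Adj w w' := hadj
  exact hw' (hw.trans hK.reachable)

variable [DecidableRel H.Adj]

theorem RobustlyConnected.insert_vertex {c : ℝ} {C : Finset V} (h : RobustlyConnected H c C) {v : V}
    (hv : v ∉ C) (hdeg : c ≤ #{w ∈ C | H.Adj v w}) : RobustlyConnected H c (insert v C) := by
  refine ⟨h.1.trans_le (by exact_mod_cast card_le_card (subset_insert v C)), ?_⟩
  have key : ∀ S A B : Finset V, A ∪ B ∪ S = insert v C → Disjoint A B → Disjoint A S →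
      Disjoint B S → B.Nonempty → (#S : ℝ) < c → v ∈ A → ∃ a ∈ A, ∃ b ∈ B, H.Adj a b := by
    intro S A B hU hAB hAS hBS hB hS hvA
    rw [Finset.disjoint_left] at hAB hAS hBS
    simp only [Finset.ext_iff, mem_union, mem_insert] at hU
    by_cases hA : (A.erase v).Nonempty
    · obtain ⟨a, ha, b, hb, hab⟩ := h.2 S (A.erase v) B (by ext x; grind)
        (by rw [Finset.disjoint_left]; grind) (by rw [Finset.disjoint_left]; grind)
        (by rw [Finset.disjoint_left]; grind) hA hB hS
      exact ⟨a, mem_of_mem_erase ha, b, hb, hab⟩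
    · rw [not_nonempty_iff_eq_empty] at hA
      have hA' : ∀ x ∈ A, x = v := fun x hx => by
        by_contra hxv
        exact notMem_empty x (hA ▸ mem_erase.2 ⟨hxv, hx⟩)
      obtain ⟨w, hw, hwS⟩ : ∃ w ∈ ({w ∈ C | H.Adj v w} : Finset V), w ∉ S := by
        refine exists_mem_notMem_of_card_lt_card ?_
        exact_mod_cast hS.trans_le hdeg
      rw [mem_filter] at hw
      exact ⟨v, hvA, w, by grind, hw.2⟩
  intro S A B hU hAB hAS hBS hA hB hS
  have hmem : v ∈ A ∪ B ∪ S := hU ▸ mem_insert_self v C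
  rw [mem_union, mem_union] at hmem
  rcases hmem with (hvA | hvB) | hvS
  · exact key S A B hU hAB hAS hBS hB hS hvA
  · obtain ⟨b, hb, a, ha, hab⟩ := key S B A (by rwa [union_comm B A]) hAB.symm hBS hAS hA hS hvB
    exact ⟨a, ha, b, hb, hab.symm⟩
  · rw [Finset.disjoint_left] at hAS hBS
    simp only [Finset.ext_iff, mem_union, mem_insert] at hU
    refine h.2 (S.erase v) A B (by ext x; grind) hAB (by rw [Finset.disjoint_left]; grind)
      (by rw [Finset.disjoint_left]; grind) hA hB (lt_of_le_of_lt ?_ hS)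
    exact_mod_cast card_le_card (erase_subset v S)

theorem SimpleGraph.card_interedges_self_le_erase (W : Finset V) (v : V) :
    #(H.interedges W W) ≤
      #(H.interedges (W.erase v) (W.erase v)) + 2 * #{w ∈ W | H.Adj v w} := by
  have hsub : H.interedges W W ⊆ H.interedges (W.erase v) (W.erase v) ∪
      (({w ∈ W | H.Adj v w} : Finset V).image (fun w => (v, w)) ∪
        ({w ∈ W | H.Adj v w} : Finset V).image (fun w => (w, v))) := by
    rintro ⟨x, y⟩ hxy
    rw [SimpleGraph.mk_mem_interedges_iff] at hxy
    have := hxy.2.2.symm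
    simp only [mem_union, SimpleGraph.mk_mem_interedges_iff, mem_image, mem_filter, mem_erase,
      Prod.mk.injEq]
    grind
  have h₁ := (card_le_card hsub).trans (card_union_le _ _)
  have h₂ := card_union_le (({w ∈ W | H.Adj v w} : Finset V).image (fun w => (v, w)))
    (({w ∈ W | H.Adj v w} : Finset V).image (fun w => (w, v)))
  have h₃ := card_image_le (s := ({w ∈ W | H.Adj v w} : Finset V)) (f := fun w => (v, w))
  have h₄ := card_image_le (s := ({w ∈ W | H.Adj v w} : Finset V)) (f := fun w => (w, v))
  omega

theorem SimpleGraph.card_interedges_self_le_of_separated {A B S : Finset V}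
    (hsep : ∀ a ∈ A, ∀ b ∈ B, ¬ H.Adj a b) :
    #(H.interedges (A ∪ B ∪ S) (A ∪ B ∪ S)) ≤
      #(H.interedges (A ∪ S) (A ∪ S)) + #(H.interedges (B ∪ S) (B ∪ S)) := by
  refine (card_le_card ?_).trans (card_union_le _ _)
  rintro ⟨x, y⟩ hxy
  simp only [mem_union, SimpleGraph.mk_mem_interedges_iff] at hxy ⊢
  have h₁ := hsep x
  have h₂ := fun hy hx => hsep y hy x hx hxy.2.2.symm
  grind

/-- A form of Mader's theorem: a nonempty vertex set of minimum degree at least `d` contains a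
robustly connected set, of threshold `d / 4`, with at least `d / 2` vertices. -/
theorem exists_robustlyConnected_subset {d c : ℝ} (hd : 0 < d) (hc : c ≤ d / 4) {U : Finset V}
    (hU : U.Nonempty) (hdeg : ∀ v ∈ U, d ≤ #{w ∈ U | H.Adj v w}) :
    ∃ W ⊆ U, d / 2 ≤ #W ∧ RobustlyConnected H c W := by
  classical
  let Dense : Finset V → Prop := fun W =>
    d / 2 ≤ #W ∧ d * (#W - d / 4) < #(H.interedges W W)
  have hUdense : Dense U := by
    obtain ⟨v, hv⟩ := hU
    have hle : (#{w ∈ U | H.Adj v w} : ℝ) ≤ #U := by exact_mod_cast card_filter_le _ _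
    refine ⟨by linarith [hdeg v hv], ?_⟩
    have hsum : (#U : ℝ) * d ≤ #(H.interedges U U) := by
      rw [SimpleGraph.card_interedges_eq_sum, Nat.cast_sum, ← nsmul_eq_mul]
      exact card_nsmul_le_sum U _ d hdeg
    nlinarith
  obtain ⟨W, hW, hmin⟩ := exists_min_image {W ∈ U.powerset | Dense W} card
    ⟨U, mem_filter.2 ⟨mem_powerset_self U, hUdense⟩⟩
  obtain ⟨hWU, hWsize, hWedges⟩ : W ⊆ U ∧ Dense W := by simpa using hW
  have hsmall : ∀ W' ⊆ W, #W' < #W → d / 2 ≤ #W' →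
      (#(H.interedges W' W') : ℝ) ≤ d * (#W' - d / 4) := by
    intro W' hW' hlt hsize
    by_contra! hcon
    exact absurd (hmin W' (mem_filter.2 ⟨mem_powerset.2 (hW'.trans hWU), hsize, hcon⟩))
      (not_le.2 hlt)
  have hWdeg : ∀ v ∈ W, d / 2 < #{w ∈ W | H.Adj v w} := by
    intro v hv
    by_contra! hcon
    have hcard : (#(W.erase v) : ℝ) + 1 = #W := by exact_mod_cast card_erase_add_one hv
    by_cases hsize : d / 2 ≤ #(W.erase v)
    · have h₁ := hsmall _ (erase_subset v W) (card_erase_lt_of_mem hv) hsize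
      have h₂ : (#(H.interedges W W) : ℝ) ≤
          #(H.interedges (W.erase v) (W.erase v)) + 2 * #{w ∈ W | H.Adj v w} := by
        exact_mod_cast SimpleGraph.card_interedges_self_le_erase W v
      nlinarith
    · push Not at hsize
      have h₁ : (#(H.interedges W W) : ℝ) ≤ #W * #(W.erase v) := by
        rw [card_erase_of_mem hv]
        norm_cast
        rw [SimpleGraph.card_interedges_eq_sum, ← smul_eq_mul]
        refine sum_le_card_nsmul W _ _ fun u hu => ?_
        rw [← card_erase_of_mem hu]
        refine card_le_card fun w hw => ?_
        rw [mem_filter] at hw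
        exact mem_erase.2 ⟨hw.2.ne', hw.1⟩
      nlinarith
  refine ⟨W, hWU, hWsize, by linarith, ?_⟩
  intro S A B hcov hAB hAS hBS hA hB hS
  by_contra! hsep
  have hside : ∀ A B : Finset V, A ∪ B ∪ S = W → A.Nonempty → (∀ a ∈ A, ∀ b ∈ B, ¬ H.Adj a b) →
      d / 2 ≤ #(A ∪ S) := by
    intro A B hcov ⟨a, ha⟩ hsep
    refine (hWdeg a (by rw [← hcov]; simp [ha])).le.trans ?_
    norm_cast
    refine card_le_card fun w hw => ?_
    rw [mem_filter, ← hcov] at hw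
    have := hsep a ha w
    grind
  have hAsize := hside A B hcov hA hsep
  have hBsize := hside B A (by rwa [union_comm B A]) hB fun b hb a ha hab => hsep a ha b hb hab.symm
  have hABS : #W = #A + #B + #S := by
    rw [← hcov, card_union_of_disjoint (disjoint_union_left.2 ⟨hAS, hBS⟩),
      card_union_of_disjoint hAB]
  have hAcard := card_union_of_disjoint hAS
  have hBcard := card_union_of_disjoint hBS
  have hApos := hA.card_pos
  have hBpos := hB.card_pos
  have h₁ := hsmall (A ∪ S) (by rw [← hcov]; grind) (by omega) hAsize
  have h₂ := hsmall (B ∪ S) (by rw [← hcov]; grind) (by omega) hBsize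
  have h₃ : (#(H.interedges W W) : ℝ) ≤
      #(H.interedges (A ∪ S) (A ∪ S)) + #(H.interedges (B ∪ S) (B ∪ S)) := by
    rw [← hcov]
    exact_mod_cast SimpleGraph.card_interedges_self_le_of_separated hsep
  rw [hAcard] at h₁
  rw [hBcard] at h₂
  rw [hABS] at hWedges
  push_cast at h₁ h₂ hWedges
  nlinarith

/-- The vertex set of a graph of minimum degree at least `k` is partitioned into robustly connected
sets of at least `k / 8` vertices. -/
theorem exists_robustlyConnected_partition [Fintype V] {k : ℝ} (hk : 0 < k)
    (hdeg : ∀ v, k ≤ #{w | H.Adj v w}) :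
    ∃ F : Finset (Finset V), (F : Set (Finset V)).PairwiseDisjoint id ∧
      F.biUnion id = univ ∧
      ∀ C ∈ F, RobustlyConnected H (k ^ 2 / (16 * Fintype.card V)) C ∧ k / 8 ≤ #C := by
  classical
  set c : ℝ := k ^ 2 / (16 * Fintype.card V) with hc
  let Valid : Finset (Finset V) → Prop := fun F =>
    (F : Set (Finset V)).PairwiseDisjoint id ∧ ∀ C ∈ F, RobustlyConnected H c C ∧ k / 8 ≤ #C
  obtain ⟨F, hF, hmax⟩ := exists_max_image (univ.filter Valid) (fun F => #(F.biUnion id))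
    ⟨∅, by simp [Valid]⟩
  obtain ⟨hdisj, hgood⟩ : Valid F := by simpa using hF
  refine ⟨F, hdisj, ?_, hgood⟩
  by_contra hne
  have hmax' : ∀ F', Valid F' → ¬ F.biUnion id ⊂ F'.biUnion id := fun F' hF' hlt =>
    absurd (hmax F' (mem_filter.2 ⟨mem_univ _, hF'⟩)) (not_le.2 (card_lt_card hlt))
  set U : Finset V := (F.biUnion id)ᶜ with hUdef
  have hUmem : ∀ v, v ∈ U ↔ ∀ C ∈ F, v ∉ C := by simp [hUdef]
  have hU : U.Nonempty := by
    rw [nonempty_iff_ne_empty, hUdef, Ne, compl_eq_empty_iff]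
    exact hne
  have hdisj' : ∀ C ∈ F, ∀ D ∈ F, ∀ x ∈ C, x ∈ D → C = D := by
    intro C hC D hD x hxC hxD
    by_contra hCD
    exact Finset.disjoint_left.1 (hdisj hC hD hCD) hxC hxD
  have hfew : ∀ v ∈ U, ∀ C ∈ F, (#{w ∈ C | H.Adj v w} : ℝ) ≤ c := by
    intro v hv C hC
    by_contra! hcon
    have hvF := (hUmem v).1 hv
    refine hmax' (insert (insert v C) (F.erase C)) ⟨?_, ?_⟩ ?_
    · intro D hD E hE hDE
      rw [Function.onFun, Finset.disjoint_left]
      simp only [id]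
      intro x hxD hxE
      rw [mem_coe, mem_insert, mem_erase] at hD hE
      rcases hD with rfl | hD <;> rcases hE with rfl | hE
      · exact hDE rfl
      · rcases mem_insert.1 hxD with rfl | hxC
        · exact hvF E hE.2 hxE
        · exact hE.1 (hdisj' E hE.2 C hC x hxE hxC)
      · rcases mem_insert.1 hxE with rfl | hxC
        · exact hvF D hD.2 hxD
        · exact hD.1 (hdisj' D hD.2 C hC x hxD hxC)
      · exact hDE (hdisj' D hD.2 E hE.2 x hxD hxE)
    · intro D hD
      rw [mem_insert] at hD
      rcases hD with rfl | hD
      · refine ⟨(hgood C hC).1.insert_vertex (hvF C hC) hcon.le, (hgood C hC).2.trans ?_⟩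
        exact_mod_cast card_le_card (subset_insert v C)
      · exact hgood D (mem_of_mem_erase hD)
    · rw [Finset.ssubset_iff_of_subset]
      · exact ⟨v, by simp, by simpa using hvF⟩
      · intro x hx
        simp only [mem_biUnion, id, mem_insert, mem_erase] at hx ⊢
        obtain ⟨D, hD, hxD⟩ := hx
        by_cases hDC : D = C
        · exact ⟨insert v C, Or.inl rfl, mem_insert_of_mem (hDC ▸ hxD)⟩
        · exact ⟨D, Or.inr ⟨hDC, hD⟩, hxD⟩
  obtain ⟨v₀, hv₀⟩ := hU
  have hkn : k ≤ Fintype.card V := by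
    refine (hdeg v₀).trans ?_
    exact_mod_cast card_le_univ _
  have hn : (0 : ℝ) < Fintype.card V := hk.trans_le hkn
  have hc₀ : 0 ≤ c := by positivity
  have hFcard : (#F : ℝ) * (k / 8) ≤ Fintype.card V := by
    have h₁ : (#F : ℝ) * (k / 8) ≤ ∑ C ∈ F, (#C : ℝ) := by
      rw [← nsmul_eq_mul]
      exact card_nsmul_le_sum F _ _ fun C hC => (hgood C hC).2
    refine h₁.trans ?_
    have h₂ : #(F.biUnion id) = ∑ C ∈ F, #C := card_biUnion hdisj
    have h₃ := card_le_univ (F.biUnion id)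
    rw [h₂] at h₃
    exact_mod_cast h₃
  have hFc : (#F : ℝ) * c ≤ k / 2 := by
    have h : (#F : ℝ) * c = (#F * (k / 8)) * (k / (2 * Fintype.card V)) := by
      rw [hc]; field_simp; ring
    rw [h]
    calc _ ≤ Fintype.card V * (k / (2 * Fintype.card V)) := by gcongr
      _ = k / 2 := by field_simp
  have hUdeg : ∀ v ∈ U, k / 2 ≤ #{w ∈ U | H.Adj v w} := by
    intro v hv
    have hsub : ({w | H.Adj v w} : Finset V) ⊆
        {w ∈ U | H.Adj v w} ∪ F.biUnion fun C => {w ∈ C | H.Adj v w} := by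
      intro w hw
      simp only [mem_filter, mem_univ, true_and] at hw
      simp only [mem_union, mem_filter, mem_biUnion, hUmem]
      by_cases h : ∃ C ∈ F, w ∈ C
      · obtain ⟨C, hC, hwC⟩ := h
        exact Or.inr ⟨C, hC, hwC, hw⟩
      · push Not at h
        exact Or.inl ⟨h, hw⟩
    have h₁ : #{w | H.Adj v w} ≤ #{w ∈ U | H.Adj v w} + ∑ C ∈ F, #{w ∈ C | H.Adj v w} :=
      (card_le_card hsub).trans ((card_union_le _ _).trans (by gcongr; exact card_biUnion_le))
    have h₂ : (#{w | H.Adj v w} : ℝ) ≤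
        #{w ∈ U | H.Adj v w} + ∑ C ∈ F, (#{w ∈ C | H.Adj v w} : ℝ) := by exact_mod_cast h₁
    have h₃ : ∑ C ∈ F, (#{w ∈ C | H.Adj v w} : ℝ) ≤ #F * c := by
      rw [← nsmul_eq_mul]
      exact sum_le_card_nsmul F _ _ (hfew v hv)
    linarith [hdeg v]
  have hck : c ≤ k / 2 / 4 := by
    rw [hc, div_le_iff₀ (by positivity)]
    nlinarith
  obtain ⟨W, hWU, hWsize, hW⟩ :=
    exists_robustlyConnected_subset (half_pos hk) hck ⟨v₀, hv₀⟩ hUdeg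
  have hWF : ∀ C ∈ F, ∀ x ∈ W, x ∉ C := fun C hC x hx => (hUmem x).1 (hWU hx) C hC
  refine hmax' (insert W F) ⟨?_, ?_⟩ ?_
  · rw [coe_insert]
    refine hdisj.insert fun C hC _ => Finset.disjoint_left.2 fun x hx => hWF C hC x hx
  · intro C hC
    rcases mem_insert.1 hC with rfl | hC
    · exact ⟨hW, by linarith⟩
    · exact hgood C hC
  · have hWpos : W.Nonempty := by
      rw [← card_pos]
      have : (0 : ℝ) < #W := by linarith
      exact_mod_cast this
    obtain ⟨x, hx⟩ := hWpos
    rw [Finset.ssubset_iff_of_subset (biUnion_subset_biUnion_of_subset_left _ (subset_insert W F))]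
    exact ⟨x, mem_biUnion.2 ⟨W, mem_insert_self W F, hx⟩, by simpa using fun C hC => hWF C hC x hx⟩

end Helpers

/-- Let `H` be a graph on `n` vertices with minimum degree `k > 0`. Then
there is a partition `V = V₁ ∪ … ∪ V_t` into pairwise disjoint nonempty parts such that each
induced subgraph `H[Vᵢ]` is `k²/(16n)`-connected and `|Vᵢ| ≥ k/8`. -/
theorem partition_into_highly_connected_parts (n k : ℕ) (hk : 0 < k)
    (H : SimpleGraph (Fin n))
    (hmin : ∀ v : Fin n, k ≤ (H.neighborSet v).ncard) :
    ∃ (t : ℕ) (P : Fin t → Set (Fin n)),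
      (∀ i, (P i).Nonempty) ∧
      (Pairwise fun i j => Disjoint (P i) (P j)) ∧
      (⋃ i, P i) = Set.univ ∧
      ∀ i, RealConnected (H.induce (P i)) (P i).ncard ((k : ℝ) ^ 2 / (16 * n)) ∧
        (k : ℝ) / 8 ≤ ((P i).ncard : ℝ) := by
  classical
  have hk' : (0 : ℝ) < k := by exact_mod_cast hk
  have hdeg : ∀ v, (k : ℝ) ≤ (Finset.univ.filter fun w => H.Adj v w).card := by
    intro v
    have h := hmin v
    rw [Set.ncard_eq_toFinset_card'] at h
    have hset : (H.neighborSet v).toFinset = Finset.univ.filter fun w => H.Adj v w := by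
      ext w; simp
    rw [hset] at h
    exact_mod_cast h
  obtain ⟨F, hdisj, hcover, hF⟩ := exists_robustlyConnected_partition hk' hdeg
  rw [Fintype.card_fin] at hF
  have hmem : ∀ i, (F.equivFin.symm i : Finset (Fin n)) ∈ F := fun i => (F.equivFin.symm i).2
  refine ⟨F.card, fun i => (F.equivFin.symm i : Finset (Fin n)), fun i => ?_, fun i j hij => ?_, ?_,
    fun i => ⟨(hF _ (hmem i)).1.realConnected, ?_⟩⟩
  · rw [Finset.coe_nonempty, ← Finset.card_pos]
    have : (0 : ℝ) < (F.equivFin.symm i : Finset (Fin n)).card := by linarith [(hF _ (hmem i)).2]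
    exact_mod_cast this
  · exact Finset.disjoint_coe.2 <| hdisj (hmem i) (hmem j) fun h => hij (F.equivFin.symm.injective (Subtype.ext h))
  · refine Set.eq_univ_of_forall fun x => ?_
    obtain ⟨C, hC, hx⟩ := Finset.mem_biUnion.1 (hcover ▸ Finset.mem_univ x)
    exact Set.mem_iUnion.2 ⟨F.equivFin ⟨C, hC⟩, by simpa using hx⟩
  · rw [Set.ncard_coe_finset]
    exact (hF _ (hmem i)).2
end

section
/- Let G be an n-vertex graph whose edges are coloured by a colouring ψ. Then G admits a ψ-rainbow spanning tree if and only if, for every 2 ≤ s ≤ n and for every partition of V(G) into s nonempty parts, the set of edges of G joining vertices in different parts of the partition receives at least s−1 distinct colours under ψ; equivalently, there are at least s−1 edges between the parts, all assigned pairwise different colours. -/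
namespace SimpleGraph

variable {V : Type*}

/-- The rational-valued functions on the vertices that are constant along every edge. -/
def locallyConstant (G : SimpleGraph V) : Submodule ℚ (V → ℚ) where
  carrier := {f | ∀ ⦃u v⦄, G.Adj u v → f u = f v}
  add_mem' hf hg u v h := by simp [hf h, hg h]
  zero_mem' _ _ _ := rfl
  smul_mem' a f hf u v h := by simp [hf h]

theorem mem_locallyConstant {G : SimpleGraph V} {f : V → ℚ} :
    f ∈ G.locallyConstant ↔ ∀ ⦃u v⦄, G.Adj u v → f u = f v :=
  Iff.rfl

theorem locallyConstant_anti {G H : SimpleGraph V} (h : G ≤ H) :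
    H.locallyConstant ≤ G.locallyConstant :=
  fun _ hf _ _ huv => hf (h huv)

theorem locallyConstant_sup (G H : SimpleGraph V) :
    (G ⊔ H).locallyConstant = G.locallyConstant ⊓ H.locallyConstant := by
  ext f
  simp only [Submodule.mem_inf, mem_locallyConstant, sup_adj]
  grind

theorem eq_of_mem_locallyConstant {G : SimpleGraph V} {f : V → ℚ} (hf : f ∈ G.locallyConstant)
    {u v : V} (h : G.Reachable u v) : f u = f v := by
  obtain ⟨p⟩ := h
  induction p with
  | nil => rfl
  | cons h _ ih => exact (hf h).trans ih

/-- Functions constant along edges are functions on the connected components. -/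
def locallyConstantEquiv (G : SimpleGraph V) :
    G.locallyConstant ≃ₗ[ℚ] (G.ConnectedComponent → ℚ) where
  toFun f c := c.lift f.1 fun _ _ p _ => eq_of_mem_locallyConstant f.2 p.reachable
  invFun g := ⟨fun v => g (G.connectedComponentMk v), fun _ _ h =>
    congrArg g (ConnectedComponent.sound h.reachable)⟩
  map_add' f g := by
    ext c
    induction c using ConnectedComponent.ind
    rfl
  map_smul' a f := by
    ext c
    induction c using ConnectedComponent.ind
    rfl
  left_inv f := rfl
  right_inv g := by
    ext c
    induction c using ConnectedComponent.ind
    rfl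

theorem finrank_locallyConstant [Finite V] (G : SimpleGraph V) :
    Module.finrank ℚ G.locallyConstant = Nat.card G.ConnectedComponent := by
  have := Fintype.ofFinite G.ConnectedComponent
  rw [G.locallyConstantEquiv.finrank_eq, Module.finrank_fintype_fun_eq_card,
    Nat.card_eq_fintype_card]

theorem card_connectedComponent_anti [Finite V] {G H : SimpleGraph V} (h : G ≤ H) :
    Nat.card H.ConnectedComponent ≤ Nat.card G.ConnectedComponent := by
  have := Fintype.ofFinite V
  rw [← finrank_locallyConstant, ← finrank_locallyConstant]
  exact Submodule.finrank_mono (locallyConstant_anti h)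

/-- The number of connected components is a supermodular function of the edge set. -/
theorem card_connectedComponent_add_le [Finite V] (G H : SimpleGraph V) :
    Nat.card G.ConnectedComponent + Nat.card H.ConnectedComponent ≤
      Nat.card (G ⊔ H).ConnectedComponent + Nat.card (G ⊓ H).ConnectedComponent := by
  have := Fintype.ofFinite V
  simp only [← finrank_locallyConstant]
  rw [← Submodule.finrank_sup_add_finrank_inf_eq, add_comm, locallyConstant_sup]
  gcongr
  exact Submodule.finrank_mono
    (sup_le (locallyConstant_anti inf_le_left) (locallyConstant_anti inf_le_right))

theorem connected_of_card_connectedComponent_le_one [Finite V] [Nonempty V] {G : SimpleGraph V}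
    (h : Nat.card G.ConnectedComponent ≤ 1) : G.Connected := by
  have := Finite.card_le_one_iff_subsingleton.mp h
  exact connected_iff _ |>.mpr
    ⟨fun u v => ConnectedComponent.exact (Subsingleton.elim _ _), inferInstance⟩

variable {κ : Type*}

/-- The spanning subgraph of `G` whose edges are those with a colour in `C`. -/
def colorRestrict (G : SimpleGraph V) (ψ : Sym2 V → κ) (C : Set κ) : SimpleGraph V where
  Adj u v := G.Adj u v ∧ ψ s(u, v) ∈ C
  symm := ⟨fun u _ h => ⟨h.1.symm, Sym2.eq_swap (a := u) ▸ h.2⟩⟩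
  loopless := ⟨fun u h => G.loopless.irrefl u h.1⟩

open scoped Classical in
/-- If discarding any set of colours leaves few enough components, then some connected spanning
subgraph is rainbow: a minimal subgraph with the same property has no repeated colour. -/
theorem exists_connected_rainbow [Finite V] [Nonempty V] (G : SimpleGraph V) (ψ : Sym2 V → κ)
    (K : Finset κ) (hG : ∀ C ⊆ K,
      Nat.card (G.colorRestrict ψ C).ConnectedComponent ≤ (K \ C).card + 1) :
    ∃ H ≤ G, H.Connected ∧ Set.InjOn ψ H.edgeSet := by
  obtain ⟨H, hHG, hmin⟩ := (Set.toFinite {H : SimpleGraph V | ∀ C ⊆ K,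
    Nat.card (H.colorRestrict ψ C).ConnectedComponent ≤ (K \ C).card + 1}).exists_le_minimal hG
  have hH := hmin.prop
  refine ⟨H, hHG, ?_, ?_⟩
  · apply connected_of_card_connectedComponent_le_one
    refine (card_connectedComponent_anti (G := H.colorRestrict ψ K) fun u v h => h.1).trans ?_
    simpa using hH K subset_rfl
  · intro e he f hf hef
    by_contra hne
    have key : ∀ e ∈ H.edgeSet, ∃ C ⊆ K, ψ e ∈ C ∧ (K \ C).card + 2 ≤
        Nat.card ((H.deleteEdges {e}).colorRestrict ψ C).ConnectedComponent := by
      intro e he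
      have hnot : ¬ ∀ C ⊆ K, Nat.card
          ((H.deleteEdges {e}).colorRestrict ψ C).ConnectedComponent ≤ (K \ C).card + 1 := by
        intro hcon
        have hle := hmin.le_of_le hcon (H.deleteEdges_le {e})
        have := edgeSet_mono hle he
        simp at this
      push Not at hnot
      obtain ⟨C, hCK, hC⟩ := hnot
      refine ⟨C, hCK, ?_, hC⟩
      by_contra heC
      refine (hC.trans_le ((card_connectedComponent_anti ?_).trans (hH C hCK))).false
      intro u v h
      refine ⟨deleteEdges_adj.mpr ⟨h.1, fun h' => heC ?_⟩, h.2⟩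
      rw [Set.mem_singleton_iff] at h'
      exact h' ▸ h.2
    obtain ⟨C, hCK, heC, hC⟩ := key e he
    obtain ⟨D, hDK, hfD, hD⟩ := key f hf
    have hsub := card_connectedComponent_add_le
      ((H.deleteEdges {e}).colorRestrict ψ C) ((H.deleteEdges {f}).colorRestrict ψ D)
    have hsup := (card_connectedComponent_anti (G := H.colorRestrict ψ ↑(C ∪ D))
      (H := (H.deleteEdges {e}).colorRestrict ψ C ⊔ (H.deleteEdges {f}).colorRestrict ψ D) (by
        rintro u v ⟨h, hc⟩
        simp only [sup_adj, colorRestrict, deleteEdges_adj, Set.mem_singleton_iff,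
          Finset.coe_union, Set.mem_union, Finset.mem_coe] at hc ⊢
        grind)).trans (hH _ (Finset.union_subset hCK hDK))
    have hinf := (card_connectedComponent_anti (G := H.colorRestrict ψ ↑((C ∩ D).erase (ψ e)))
      (H := (H.deleteEdges {e}).colorRestrict ψ C ⊓ (H.deleteEdges {f}).colorRestrict ψ D) (by
        rintro u v ⟨h, hc⟩
        simp only [inf_adj, colorRestrict, deleteEdges_adj, Set.mem_singleton_iff,
          Finset.mem_coe, Finset.mem_erase, Finset.mem_inter] at hc ⊢
        grind)).trans (hH _ ((Finset.erase_subset _ _).trans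
          (Finset.inter_subset_left.trans hCK)))
    have heCD : ψ e ∈ C ∩ D := Finset.mem_inter.mpr ⟨heC, hef ▸ hfD⟩
    have hcard := Finset.card_erase_add_one heCD
    have h₁ := Finset.card_sdiff_add_card_eq_card hCK
    have h₂ := Finset.card_sdiff_add_card_eq_card hDK
    have h₃ := Finset.card_sdiff_add_card_eq_card (Finset.union_subset hCK hDK)
    have h₄ := Finset.card_sdiff_add_card_eq_card ((Finset.erase_subset (ψ e) _).trans
      (Finset.inter_subset_left.trans hCK : C ∩ D ⊆ K))
    have h₅ := Finset.card_union_add_card_inter C D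
    omega

/-- A connected graph has at least `|W| - 1` edges joining distinct fibres of a map onto `W`. -/
theorem Connected.card_le_ncard_crossing [Finite V] {W : Type*} [Finite W] {T : SimpleGraph V}
    (hT : T.Connected) {p : V → W} (hp : Function.Surjective p) :
    Nat.card W ≤ {e ∈ T.edgeSet | ¬ (e.map p).IsDiag}.ncard + 1 := by
  let Q : SimpleGraph W :=
    fromEdgeSet (Sym2.map p '' {e ∈ T.edgeSet | ¬ (e.map p).IsDiag})
  have hstep : ∀ u v, T.Adj u v → Q.Reachable (p u) (p v) := by
    intro u v h
    by_cases hne : p u = p v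
    · rw [hne]
    · exact Adj.reachable ((fromEdgeSet_adj _).mpr ⟨⟨s(u, v), ⟨h, by simpa using hne⟩, rfl⟩, hne⟩)
  have hreach : ∀ u v, T.Reachable u v → Q.Reachable (p u) (p v) := by
    rintro u v ⟨w⟩
    induction w with
    | nil => rfl
    | cons h _ ih => exact (hstep _ _ h).trans ih
  have := hT.nonempty
  have hQ : Q.Connected := (connected_iff _).mpr
    ⟨hp.forall₂.mpr fun u v => hreach u v (hT.preconnected u v), this.map p⟩
  refine hQ.card_vert_le_card_edgeSet_add_one.trans ?_
  gcongr
  rw [Nat.card_coe_set_eq, edgeSet_fromEdgeSet]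
  exact (Set.ncard_le_ncard Set.sdiff_subset (Set.toFinite _)).trans
    (Set.ncard_image_le (Set.toFinite _))

end SimpleGraph

/-- (Criterion for rainbow spanning trees.) An edge-coloured graph `G` on a
finite nonempty vertex set admits a rainbow spanning tree if and only if, for every
`2 ≤ s ≤ n` and every partition of the vertex set into `s` nonempty parts, the edges of `G`
joining vertices in different parts receive at least `s - 1` distinct colours. -/
theorem rainbow_spanning_tree_iff {V : Type*} [Fintype V] [Nonempty V]
    (G : SimpleGraph V) {κ : Type*} (ψ : Sym2 V → κ) :
    (∃ T : SimpleGraph V, T ≤ G ∧ T.IsTree ∧ Set.InjOn ψ T.edgeSet) ↔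
      (∀ s : ℕ, 2 ≤ s → s ≤ Fintype.card V →
        ∀ P : Fin s → Set V, (∀ i, (P i).Nonempty) →
          (Pairwise fun i j => Disjoint (P i) (P j)) →
          (⋃ i, P i) = Set.univ →
          s - 1 ≤ (ψ '' {e ∈ G.edgeSet | ¬∃ i, ∀ v ∈ e, v ∈ P i}).ncard) := by
  classical
  constructor
  · rintro ⟨T, hTG, hT, hinj⟩ s - - P hne hdisj hcover
    have hmem : ∀ v, ∃ i, v ∈ P i := fun v => Set.mem_iUnion.mp (hcover ▸ Set.mem_univ v)
    choose p hp using hmem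
    have hp' : ∀ {v i}, v ∈ P i → p v = i := fun {v i} hv => by
      by_contra h
      exact Set.disjoint_left.mp (hdisj h) (hp v) hv
    have hsurj : Function.Surjective p := fun i => (hne i).imp fun _ => hp'
    have hcard := hT.connected.card_le_ncard_crossing hsurj
    rw [Nat.card_eq_fintype_card, Fintype.card_fin] at hcard
    rw [tsub_le_iff_right]
    refine hcard.trans (Nat.add_le_add_right ?_ 1)
    rw [← (hinj.mono fun e he => he.1).ncard_image]
    refine Set.ncard_le_ncard (Set.image_mono ?_) (Set.toFinite _)
    rintro e ⟨he, hdiag⟩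
    refine ⟨SimpleGraph.edgeSet_mono hTG he, ?_⟩
    rintro ⟨i, hi⟩
    induction e with
    | _ u v => exact hdiag (by simp [hp' (hi u (by simp)), hp' (hi v (by simp))])
  · intro h
    let K : Finset κ := (Set.toFinite (ψ '' G.edgeSet)).toFinset
    have hK : ∀ e ∈ G.edgeSet, ψ e ∈ K := fun e he => by
      simpa [K] using ⟨e, he, rfl⟩
    obtain ⟨H, hHG, hH, hinj⟩ := G.exists_connected_rainbow ψ K fun C _ => by
      set R := G.colorRestrict ψ C
      by_cases hs : 2 ≤ Nat.card R.ConnectedComponent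
      · let E := Finite.equivFin R.ConnectedComponent
        have hsV : Nat.card R.ConnectedComponent ≤ Fintype.card V := by
          rw [← Nat.card_eq_fintype_card]
          exact Nat.card_le_card_of_surjective R.connectedComponentMk Quot.mk_surjective
        have hle := h _ hs hsV (fun i => (E.symm i).supp) (fun i => (E.symm i).nonempty_supp)
          (fun i j hij => SimpleGraph.pairwise_disjoint_supp_connectedComponent R
            (E.symm.injective.ne hij))
          (Set.eq_univ_of_forall fun v => Set.mem_iUnion.mpr
            ⟨E (R.connectedComponentMk v), by simp⟩)
        rw [tsub_le_iff_right] at hle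
        refine hle.trans (Nat.add_le_add_right ?_ 1)
        rw [← Set.ncard_coe_finset]
        refine Set.ncard_le_ncard ?_ (Set.toFinite _)
        rintro _ ⟨e, ⟨he, hcross⟩, rfl⟩
        refine Finset.mem_coe.mpr (Finset.mem_sdiff.mpr ⟨hK e he, fun heC => hcross ?_⟩)
        induction e with
        | _ u v =>
          refine ⟨E (R.connectedComponentMk u), ?_⟩
          have huv : R.Adj u v := ⟨he, heC⟩
          simpa using (SimpleGraph.ConnectedComponent.sound huv.reachable).symm
      · omega
    obtain ⟨T, hTH, hT⟩ := hH.exists_isTree_le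
    exact ⟨T, hTH.trans hHG, hT, hinj.mono (SimpleGraph.edgeSet_mono hTH)⟩
end

section
/- Let H be a graph with an edge-colouring ψ, let T be a tree, and let S be a subtree of T. Let f : V(S) → V(H) be an injective graph homomorphism (an embedding of S into H) whose image tree 𝒮 := f(S) is ψ-rainbow. Suppose: (i) x ∈ V(𝒮) is such that all T-neighbours of the node f⁻¹(x) lie in V(S); (ii) u' ∈ V(S) and v' ∈ V(T) \ V(S) satisfy u'v' ∈ E(T), and u := f(u'); (iii) v ∈ V(H) \ V(𝒮); (iv) ux ∈ E(H) and N_𝒮(x) ⊆ N_H(v); and (v) the colours in the set {ψ(ux)} ∪ {ψ(yv) : y ∈ N_𝒮(x)} are pairwise distinct, none of them appearing on an edge of 𝒮. Then the map f̃ defined by f̃(f⁻¹(x)) = v, f̃(v') = x, and f̃(z) = f(z) for every other z ∈ V(S), is an injective graph homomorphism of the subtree of T induced by V(S) ∪ {v'} into H whose image is ψ-rainbow. -/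
/-- In an acyclic graph, a vertex outside a connected vertex set has at most one neighbour
in that set. -/
theorem SimpleGraph.IsAcyclic.eq_of_adj_of_notMem {V : Type*} {G : SimpleGraph V}
    (hG : G.IsAcyclic) {s : Set V} (hs : (G.induce s).Connected) {a b w : V}
    (ha : a ∈ s) (hb : b ∈ s) (hw : w ∉ s) (haw : G.Adj a w) (hbw : G.Adj b w) : a = b := by
  obtain ⟨p, hp⟩ := (hs.preconnected ⟨a, ha⟩ ⟨b, hb⟩).exists_isPath
  let q : G.Walk a b := p.map (SimpleGraph.Embedding.induce s).toHom
  have hq : q.IsPath := hp.map (SimpleGraph.Embedding.induce (G := G) s).injective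
  have hwq : w ∉ q.support := by
    intro h
    obtain ⟨z, -, rfl⟩ := List.mem_map.1 ((SimpleGraph.Walk.support_map _ p) ▸ h)
    exact hw z.2
  have heq := (hG.subsingleton_path w b).elim ⟨SimpleGraph.Walk.cons haw.symm q, hq.cons hwq⟩
    (SimpleGraph.Path.singleton hbw.symm)
  have hlen := congrArg (fun r : G.Path w b => r.1.length) heq
  have hq0 : q.length = 0 := by
    simpa [SimpleGraph.Path.singleton] using hlen
  exact SimpleGraph.Walk.eq_of_length_eq_zero hq0


/-- (Correctness of a single rainbow absorption step.) Let `H` be a graph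
with edge-colouring `ψ`, let `T` be a tree and `S` the subtree of `T` induced on a vertex set
`VS`, and let `f` be an injective homomorphism of `S` into `H` with `ψ`-rainbow image `𝒮`.
Suppose `x' ∈ VS` has all its `T`-neighbours in `VS` (so `x := f x'` is completely resolved),
`u' ∈ VS` and `v' ∉ VS` satisfy `u'v' ∈ E(T)`, `v` is a vertex of `H` outside the image of
`f`, `f u'` is `H`-adjacent to `f x'`, every `𝒮`-neighbour of `f x'` is an `H`-neighbour of
`v`, and the colours `ψ(f u', f x')` and `ψ(f y, v)` for `T`-neighbours `y` of `x'` are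
pairwise distinct and do not appear on `𝒮`. Then the map `f̃` obtained from `f` by resetting
the image of `x'` to `v` and sending `v'` to `f x'` is an injective homomorphism of the
subtree of `T` induced on `VS ∪ {v'}` into `H` whose image is `ψ`-rainbow. -/
theorem rainbow_absorption_step {W VT κ : Type*} [DecidableEq VT]
    (H : SimpleGraph W) (ψ : Sym2 W → κ)
    (T : SimpleGraph VT) (hT : T.IsTree)
    (VS : Set VT) (hVSconn : (T.induce VS).Connected)
    (f : VT → W)
    (hfInj : Set.InjOn f VS)
    (hfHom : ∀ a ∈ VS, ∀ b ∈ VS, T.Adj a b → H.Adj (f a) (f b))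
    (hfRainbow : ∀ a ∈ VS, ∀ b ∈ VS, ∀ a' ∈ VS, ∀ b' ∈ VS,
      T.Adj a b → T.Adj a' b' → s(a, b) ≠ s(a', b') →
      ψ s(f a, f b) ≠ ψ s(f a', f b'))
    -- (i) a completely resolved vertex `x'` of `S`
    (x' : VT) (hx' : x' ∈ VS) (hres : ∀ y, T.Adj x' y → y ∈ VS)
    -- (ii) an edge `u'v'` of `T` leaving `S`
    (u' : VT) (hu' : u' ∈ VS) (v' : VT) (hv' : v' ∉ VS) (huv' : T.Adj u' v')
    -- (iii) a vertex `v` of `H` outside the image tree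
    (v : W) (hv : v ∉ f '' VS)
    -- (iv) adjacency conditions in `H`
    (hux : H.Adj (f u') (f x'))
    (hnbrs : ∀ y ∈ VS, T.Adj x' y → H.Adj v (f y))
    -- (v) colour conditions
    (hc1 : ∀ y ∈ VS, T.Adj x' y → ψ s(f u', f x') ≠ ψ s(f y, v))
    (hc2 : ∀ y₁ ∈ VS, ∀ y₂ ∈ VS, T.Adj x' y₁ → T.Adj x' y₂ → y₁ ≠ y₂ →
      ψ s(f y₁, v) ≠ ψ s(f y₂, v))
    (hc3 : ∀ a ∈ VS, ∀ b ∈ VS, T.Adj a b →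
      ψ s(f u', f x') ≠ ψ s(f a, f b) ∧
      ∀ y ∈ VS, T.Adj x' y → ψ s(f y, v) ≠ ψ s(f a, f b)) :
    ∃ ft : VT → W,
      (∀ z, ft z = if z = x' then v else if z = v' then f x' else f z) ∧
      Set.InjOn ft (insert v' VS) ∧
      (∀ a ∈ insert v' VS, ∀ b ∈ insert v' VS, T.Adj a b → H.Adj (ft a) (ft b)) ∧
      (∀ a ∈ insert v' VS, ∀ b ∈ insert v' VS, ∀ a' ∈ insert v' VS, ∀ b' ∈ insert v' VS,
        T.Adj a b → T.Adj a' b' → s(a, b) ≠ s(a', b') →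
        ψ s(ft a, ft b) ≠ ψ s(ft a', ft b')) := by
  have hux' : u' ≠ x' := by
    rintro rfl
    exact hv' (hres v' huv')
  have hvx' : v' ≠ x' := fun h => hv' (h ▸ hx')
  have hfv : ∀ z ∈ VS, f z ≠ v := fun z hz h => hv ⟨z, hz, h⟩
  have hnb : ∀ a ∈ VS, T.Adj a v' → a = u' := fun a ha hav =>
    hT.isAcyclic.eq_of_adj_of_notMem hVSconn ha hu' hv' hav huv'
  obtain ⟨ft, hft⟩ : ∃ ft : VT → W,
      ∀ z, ft z = if z = x' then v else if z = v' then f x' else f z := ⟨_, fun _ => rfl⟩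
  have hftx : ft x' = v := by simp [hft]
  have hftv : ft v' = f x' := by simp [hft, hvx']
  have hftf : ∀ z ∈ VS, z ≠ x' → ft z = f z := fun z hz hzx => by
    have hzv : z ≠ v' := fun h => hv' (h ▸ hz)
    simp [hft, hzx, hzv]
  have hedge : ∀ a ∈ insert v' VS, ∀ b ∈ insert v' VS, T.Adj a b →
      (s(a, b) = s(u', v') ∧ s(ft a, ft b) = s(f u', f x')) ∨
      (∃ y ∈ VS, T.Adj x' y ∧ s(a, b) = s(y, x') ∧ s(ft a, ft b) = s(f y, v)) ∨
      (a ∈ VS ∧ b ∈ VS ∧ s(ft a, ft b) = s(f a, f b)) := by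
    rintro a (rfl | ha) b (rfl | hb) hab
    · exact (T.irrefl hab).elim
    · obtain rfl := hnb b hb hab.symm
      exact Or.inl ⟨Sym2.eq_swap, by rw [hftv, hftf b hb hux', Sym2.eq_swap]⟩
    · obtain rfl := hnb a ha hab
      exact Or.inl ⟨rfl, by rw [hftv, hftf a ha hux']⟩
    · by_cases hax : a = x'
      · subst hax
        exact Or.inr <| Or.inl
          ⟨b, hb, hab, Sym2.eq_swap, by rw [hftx, hftf b hb hab.ne', Sym2.eq_swap]⟩
      · by_cases hbx : b = x'
        · subst hbx
          exact Or.inr <| Or.inl ⟨a, ha, hab.symm, rfl, by rw [hftx, hftf a ha hax]⟩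
        · exact Or.inr <| Or.inr ⟨ha, hb, by rw [hftf a ha hax, hftf b hb hbx]⟩
  refine ⟨ft, hft, ?_, ?_, ?_⟩
  · have hcover : ∀ z ∈ insert v' VS, z = x' ∨ z = v' ∨ z ∈ VS ∧ z ≠ x' := by
      rintro z (rfl | hz)
      · exact Or.inr (Or.inl rfl)
      · exact (eq_or_ne z x').imp_right fun h => Or.inr ⟨hz, h⟩
    intro a ha b hb hab
    rcases hcover a ha with rfl | rfl | ⟨ha', hax⟩ <;>
      rcases hcover b hb with rfl | rfl | ⟨hb', hbx⟩
    · rfl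
    · exact (hfv _ hx' (by rw [← hftv, ← hab, hftx])).elim
    · exact (hfv _ hb' (by rw [← hftf _ hb' hbx, ← hab, hftx])).elim
    · exact (hfv _ hx' (by rw [← hftv, hab, hftx])).elim
    · rfl
    · rw [hftv, hftf _ hb' hbx] at hab
      exact (hbx (hfInj hb' hx' hab.symm)).elim
    · exact (hfv _ ha' (by rw [← hftf _ ha' hax, hab, hftx])).elim
    · rw [hftv, hftf _ ha' hax] at hab
      exact (hax (hfInj ha' hx' hab)).elim
    · rw [hftf _ ha' hax, hftf _ hb' hbx] at hab
      exact hfInj ha' hb' hab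
  · intro a ha b hb hab
    rw [← SimpleGraph.mem_edgeSet]
    rcases hedge a ha b hb hab with ⟨-, h⟩ | ⟨y, hy, hxy, -, h⟩ | ⟨ha, hb, h⟩ <;> rw [h]
    · exact hux
    · exact (hnbrs y hy hxy).symm
    · exact hfHom a ha b hb hab
  · intro a ha b hb c hc d hd hab hcd hne
    rcases hedge a ha b hb hab with ⟨e, h⟩ | ⟨y, hy, hxy, e, h⟩ | ⟨ha, hb, h⟩ <;>
      rcases hedge c hc d hd hcd with ⟨e', h'⟩ | ⟨z, hz, hxz, e', h'⟩ | ⟨hc, hd, h'⟩ <;>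
      rw [h, h']
    · exact (hne (e.trans e'.symm)).elim
    · exact hc1 z hz hxz
    · exact (hc3 c hc d hd hcd).1
    · exact (hc1 y hy hxy).symm
    · refine hc2 y hy z hz hxy hxz fun hyz => hne ?_
      rw [e, e', hyz]
    · exact (hc3 c hc d hd hcd).2 y hy hxy
    · exact (hc3 a ha b hb hab).1.symm
    · exact ((hc3 a ha b hb hab).2 z hz hxz).symm
    · exact hfRainbow a ha b hb c hc d hd hab hcd hne
end

section
/- Let d ≥ 2 be an integer and let ε ∈ (0,1) satisfy (d+1)ε < 1. Let T be a tree on n vertices with maximum degree at most d, and let T₀ be a subtree of T on ⌈(1−ε)n⌉ vertices obtained from T by successively removing leaves. Then there exists a set I₀ ⊆ V(T₀) satisfying: (Q.1) the distance in T₀ between any two distinct vertices of I₀ is at least 3; (Q.2) N_T(x) ⊆ V(T₀) for every x ∈ I₀; and (Q.3) |I₀| ≥ ⌊(n − (d+1)εn)/(d²+1)⌋. -/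
/-- Greedy bound: if every closed neighbourhood of the symmetric relation `r` is contained in a
finset with at most `k` elements, then `U` contains an `r`-independent set `I` with
`#U ≤ #I * k`. -/
theorem Finset.exists_independent_card_le_mul {V : Type*} (r : V → V → Prop)
    (hr : ∀ x y, r x y → r y x) (U : Finset V) (B : V → Finset V) (k : ℕ)
    (hB : ∀ x z, z = x ∨ r x z → z ∈ B x) (hk : ∀ x, (B x).card ≤ k) :
    ∃ I ⊆ U, (∀ x ∈ I, ∀ y ∈ I, x ≠ y → ¬ r x y) ∧ U.card ≤ I.card * k := by
  classical
  let F := U.powerset.filter fun I => ∀ x ∈ I, ∀ y ∈ I, x ≠ y → ¬ r x y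
  have hF : F.Nonempty := ⟨∅, by simp [F]⟩
  obtain ⟨I, hI, hmax⟩ := Finset.exists_max_image F Finset.card hF
  obtain ⟨hIU, hind⟩ : I ⊆ U ∧ ∀ x ∈ I, ∀ y ∈ I, x ≠ y → ¬ r x y := by simpa [F] using hI
  refine ⟨I, hIU, hind, ?_⟩
  have hcover : U ⊆ I.biUnion B := by
    intro z hz
    by_contra hzB
    have hfar : ∀ x ∈ I, ¬ (z = x ∨ r x z) := fun x hx h =>
      hzB (Finset.mem_biUnion.2 ⟨x, hx, hB x z h⟩)
    have hzI : z ∉ I := fun h => hfar z h (Or.inl rfl)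
    have hins : insert z I ∈ F := by
      simp only [F, Finset.mem_filter, Finset.mem_powerset]
      refine ⟨Finset.insert_subset hz hIU, ?_⟩
      intro x hx y hy hxy hrxy
      rcases Finset.mem_insert.1 hx with rfl | hxI <;>
        rcases Finset.mem_insert.1 hy with rfl | hyI
      · exact hxy rfl
      · exact hfar y hyI (Or.inr (hr _ _ hrxy))
      · exact hfar x hxI (Or.inr hrxy)
      · exact hind x hxI y hyI hxy hrxy
    have := hmax _ hins
    rw [Finset.card_insert_of_notMem hzI] at this
    omega
  exact (Finset.card_le_card hcover).trans (Finset.card_biUnion_le_card_mul _ _ _ fun x _ => hk x)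

namespace SimpleGraph

variable {V : Type*}

/-- Deleting a vertex with exactly one neighbour inside `s` keeps the induced graph connected. -/
theorem Connected.induce_diff_singleton [Finite V] {G : SimpleGraph V} {s : Set V}
    (hs : (G.induce s).Connected) {x : V} (hx : x ∈ s)
    (hleaf : {y ∈ s | G.Adj x y}.ncard = 1) : (G.induce (s \ {x})).Connected := by
  classical
  have := Fintype.ofFinite V
  have hdeg : (G.induce s).degree ⟨x, hx⟩ = 1 := by
    obtain ⟨a, ha⟩ := Set.ncard_eq_one.1 hleaf
    have hmem : ∀ y, y ∈ s ∧ G.Adj x y ↔ y = a := fun y => by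
      simpa using Set.ext_iff.1 ha y
    rw [degree_eq_one_iff_existsUnique_adj]
    refine ⟨⟨a, ((hmem a).2 rfl).1⟩, ((hmem a).2 rfl).2, ?_⟩
    rintro ⟨b, hb⟩ hab
    exact Subtype.ext ((hmem b).1 ⟨hb, hab⟩)
  have hc := hs.induce_compl_singleton_of_degree_eq_one hdeg
  let f : (G.induce s).induce {⟨x, hx⟩}ᶜ →g G.induce (s \ {x}) :=
    { toFun := fun y => ⟨y.1.1, y.1.2, fun h => y.2 (Subtype.ext h)⟩
      map_rel' := fun h => h }
  refine hc.map f ?_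
  rintro ⟨y, hy, hyx⟩
  exact ⟨⟨⟨y, hy⟩, fun h => hyx (congrArg Subtype.val h)⟩, rfl⟩

/-- In a connected graph, distinct nonadjacent vertices without a common neighbour are at
distance at least three. -/
theorem Connected.three_le_dist {G : SimpleGraph V} (hG : G.Connected) {x y : V} (hxy : x ≠ y)
    (hadj : ¬ G.Adj x y) (hcommon : ∀ c, G.Adj x c → ¬ G.Adj c y) : 3 ≤ G.dist x y := by
  obtain ⟨p, hp⟩ := hG.exists_walk_length_eq_dist x y
  rw [← hp]
  match p with
  | .nil => exact absurd rfl hxy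
  | .cons h .nil => exact absurd h hadj
  | .cons h (.cons h' .nil) => exact absurd h' (hcommon _ h)
  | .cons _ (.cons _ (.cons _ _)) => simp only [Walk.length_cons]; omega

/-- A ball of radius two in a graph of maximum degree at most `d` has at most `d ^ 2 + 1`
vertices. -/
theorem exists_finset_ball_two_card_le [Fintype V] (G : SimpleGraph V) [DecidableRel G.Adj] {d : ℕ}
    (hd : ∀ v, G.degree v ≤ d) (x : V) :
    ∃ B : Finset V, (∀ z, z = x ∨ (G.Adj x z ∨ ∃ c, G.Adj x c ∧ G.Adj c z) → z ∈ B) ∧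
      B.card ≤ d ^ 2 + 1 := by
  classical
  refine ⟨insert x ((G.neighborFinset x).biUnion
    fun y => insert y ((G.neighborFinset y).erase x)), ?_, ?_⟩
  · intro z hz
    by_cases hzx : z = x
    · simp [hzx]
    · rcases hz with h | h | ⟨c, hc, hcz⟩
      · exact absurd h hzx
      · exact Finset.mem_insert_of_mem (Finset.mem_biUnion.2 ⟨z, by simpa using h, by simp⟩)
      · exact Finset.mem_insert_of_mem
          (Finset.mem_biUnion.2 ⟨c, by simpa using hc, by simp [hcz, hzx]⟩)
  · refine (Finset.card_insert_le _ _).trans (Nat.add_le_add_right ?_ 1)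
    have hcard : ((G.neighborFinset x).biUnion
        fun y => insert y ((G.neighborFinset y).erase x)).card ≤ (G.neighborFinset x).card * d := by
      refine Finset.card_biUnion_le_card_mul _ _ _ fun y hy => ?_
      have hxy : x ∈ G.neighborFinset y := by
        simpa [G.adj_comm] using hy
      refine (Finset.card_insert_le _ _).trans ?_
      rw [Finset.card_erase_add_one hxy]
      exact hd y
    refine hcard.trans ?_
    rw [sq]
    exact Nat.mul_le_mul_right d (hd x)

end SimpleGraph


/-- Let `d ≥ 2` and `ε ∈ (0,1)` with `(d+1)ε < 1`. Let `T` be a tree on `n`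
vertices of maximum degree at most `d`, and let `T₀` be a subtree of `T` on `⌈(1-ε)n⌉`
vertices obtained from `T` by successively removing leaves (encoded by the chain of vertex
sets `S 0 = V(T), …, S m = V₀`, each obtained from the previous by deleting a leaf of the
current induced tree). Then there is a set `I₀ ⊆ V(T₀)` such that (Q.1) any two distinct
vertices of `I₀` are at distance at least `3` in `T₀`; (Q.2) `N_T(x) ⊆ V(T₀)` for every
`x ∈ I₀`; and (Q.3) `|I₀| ≥ ⌊(n - (d+1)εn)/(d²+1)⌋`. -/
theorem exists_absorber_set (d : ℕ) (hd : 2 ≤ d) (ε : ℝ) (hε : 0 < ε ∧ ε < 1)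
    (hdε : (d + 1 : ℝ) * ε < 1)
    (n : ℕ) (T : SimpleGraph (Fin n)) (hT : T.IsTree)
    (hDeg : ∀ v, (T.neighborSet v).ncard ≤ d)
    (V₀ : Set (Fin n)) (hV₀card : V₀.ncard = ⌈(1 - ε) * (n : ℝ)⌉₊)
    (m : ℕ) (S : ℕ → Set (Fin n))
    (hS0 : S 0 = Set.univ) (hSm : S m = V₀)
    (hstep : ∀ i < m, ∃ x ∈ S i,
      {y ∈ S i | T.Adj x y}.ncard = 1 ∧ S (i + 1) = S i \ {x}) :
    ∃ (I₀ : Set (Fin n)) (hsub : I₀ ⊆ V₀),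
      (∀ (x : Fin n) (hx : x ∈ I₀) (y : Fin n) (hy : y ∈ I₀), x ≠ y →
        3 ≤ (T.induce V₀).dist ⟨x, hsub hx⟩ ⟨y, hsub hy⟩) ∧
      (∀ x ∈ I₀, ∀ y, T.Adj x y → y ∈ V₀) ∧
      ⌊((n : ℝ) - (d + 1) * ε * n) / ((d : ℝ) ^ 2 + 1)⌋₊ ≤ I₀.ncard := by
  classical
  have hdeg : ∀ v, T.degree v ≤ d := fun v => by
    rw [← T.card_neighborSet_eq_degree, ← Nat.card_eq_fintype_card]
    exact hDeg v
  have hconn : (T.induce V₀).Connected := by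
    have hS : ∀ i ≤ m, (T.induce (S i)).Connected := by
      intro i
      induction i with
      | zero =>
        intro _
        rw [hS0]
        exact (SimpleGraph.induceUnivIso T).connected_iff.2 hT.connected
      | succ i ih =>
        intro hi
        obtain ⟨x, hx, hleaf, hS'⟩ := hstep i hi
        rw [hS']
        exact (ih (Nat.le_of_succ_le hi)).induce_diff_singleton hx hleaf
    exact hSm ▸ hS m le_rfl
  let W : Finset (Fin n) := V₀ᶜ.toFinset
  let C : Finset (Fin n) := W.biUnion fun v => insert v (T.neighborFinset v)
  have hC : C.card ≤ W.card * (d + 1) :=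
    Finset.card_biUnion_le_card_mul _ _ _ fun v _ =>
      (Finset.card_insert_le _ _).trans (Nat.add_le_add_right (hdeg v) 1)
  have hW : (W.card : ℝ) ≤ ε * n := by
    have h₁ : V₀.ncard + W.card = n := by
      rw [← Set.ncard_eq_toFinset_card', Set.ncard_add_ncard_compl, Nat.card_fin]
    have h₂ : (1 - ε) * (n : ℝ) ≤ V₀.ncard := hV₀card ▸ Nat.le_ceil _
    have h₃ : (V₀.ncard : ℝ) + W.card = n := by exact_mod_cast h₁
    linarith
  have hU : (n : ℝ) - (d + 1) * ε * n ≤ (Cᶜ.card : ℝ) := by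
    have h₁ : (C.card : ℝ) + Cᶜ.card = n := by
      exact_mod_cast (Finset.card_add_card_compl C).trans (Fintype.card_fin n)
    have h₂ : (C.card : ℝ) ≤ W.card * (d + 1) := by exact_mod_cast hC
    have h₃ : (W.card : ℝ) * (d + 1) ≤ ε * n * (d + 1) :=
      mul_le_mul_of_nonneg_right hW (by positivity)
    linarith
  choose B hB hBcard using T.exists_finset_ball_two_card_le hdeg
  obtain ⟨I, hIU, hind, hcard⟩ := Finset.exists_independent_card_le_mul
    (fun x y => T.Adj x y ∨ ∃ c, T.Adj x c ∧ T.Adj c y)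
    (by
      rintro x y (h | ⟨c, hxc, hcy⟩)
      · exact Or.inl h.symm
      · exact Or.inr ⟨c, hcy.symm, hxc.symm⟩)
    Cᶜ B (d ^ 2 + 1) hB hBcard
  have hIC : ∀ x ∈ I, ∀ v, v = x ∨ T.Adj v x → v ∈ V₀ := by
    intro x hx v hv
    by_contra hvV
    refine Finset.mem_compl.1 (hIU hx) (Finset.mem_biUnion.2 ⟨v, by simpa [W] using hvV, ?_⟩)
    rcases hv with rfl | hv
    · simp
    · simp [hv]
  refine ⟨I, fun x hx => hIC x hx x (Or.inl rfl), ?_, ?_, ?_⟩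
  · intro x hx y hy hxy
    have hr := hind x hx y hy hxy
    exact hconn.three_le_dist (fun h => hxy (congrArg Subtype.val h))
      (fun h => hr (Or.inl h)) (fun c h h' => hr (Or.inr ⟨c, h, h'⟩))
  · exact fun x hx y hxy => hIC x hx y (Or.inr hxy.symm)
  · rw [Set.ncard_coe_finset]
    refine Nat.floor_le_of_le ?_
    rw [div_le_iff₀ (by positivity)]
    exact hU.trans (by exact_mod_cast hcard)
end
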